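/- For every Jordan domain Ω ⊆ ℂ, every relative Schottky set S = Ω \ ⋃_{i∈I} B_i in Ω, and all δ > 0 and ε > 0, there exists ε̃ > 0 with the following property. Let I' ⊆ I be finite and A = Ω \ ⋃_{i∈I'} closure(B_i); let Ω̃ ⊆ ℂ be a Jordan domain and Ã a relative circle domain in Ω̃; let g : closure(A) → closure(Ã) be a homeomorphism that is holomorphic with nonvanishing derivative on A, maps ∂Ω onto ∂Ω̃, and maps each peripheral circle of A onto a peripheral circle of Ã. Let p₁, p₂, p₃ ∈ ∂Ω be distinct with |p_i − p_j| ≥ δ for i ≠ j, and assume that for every p̃ ∈ ∂Ω̃ there exist i ≠ j with dist(p̃, arc(g(p_i), g(p_j))) ≥ δ, where arc(g(p_i), g(p_j)) denotes the connected component of ∂Ω̃ \ {g(p_i), g(p_j)} that does not contain g(p_k) for k ≠ i, j. Then for every compact set K ⊆ Ω with dist(K, ∂Ω) ≥ ε, one has dist(g(K ∩ closure(A)), ∂Ω̃) ≥ ε̃. -/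

import Mathlib

open Set Metric MeasureTheory Filter
open scoped NNReal ENNReal Topology

noncomputable section

/-- A (nonempty, open, connected) domain in the complex plane. -/
def IsPlaneDomain (Ω : Set ℂ) : Prop := IsOpen Ω ∧ IsConnected Ω

/-- A family of open round discs (given by centers `c` and radii `r`) whose closures
are contained in `Ω` and are pairwise disjoint. -/
def IsSchottkyFamily {I : Type*} (Ω : Set ℂ) (c : I → ℂ) (r : I → ℝ) : Prop :=
  (∀ i, 0 < r i) ∧ (∀ i, closedBall (c i) (r i) ⊆ Ω) ∧
    Pairwise fun i j => Disjoint (closedBall (c i) (r i)) (closedBall (c j) (r j))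

/-- `S` is a relative Schottky set in the domain `Ω`. -/
def IsRelativeSchottkySet (Ω S : Set ℂ) : Prop :=
  IsPlaneDomain Ω ∧
    ∃ (I : Type) (c : I → ℂ) (r : I → ℝ),
      IsSchottkyFamily Ω c r ∧ S = Ω \ ⋃ i, ball (c i) (r i)

/-- A Jordan domain: a bounded domain whose boundary is an embedded circle, and which is
a connected component of the complement of its boundary. -/
def IsJordanDomain (Ω : Set ℂ) : Prop :=
  IsPlaneDomain Ω ∧ Bornology.IsBounded Ω ∧
    (∃ γ : ℂ → ℂ, ContinuousOn γ (sphere (0 : ℂ) 1) ∧ InjOn γ (sphere (0 : ℂ) 1) ∧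
      γ '' sphere (0 : ℂ) 1 = frontier Ω) ∧
    ∀ p ∈ Ω, connectedComponentIn (frontier Ω)ᶜ p = Ω

/-- `f : ℂ → ℂ` restricts to a homeomorphism from `S` onto `T`. -/
def IsHomeoOn (f : ℂ → ℂ) (S T : Set ℂ) : Prop :=
  ∃ e : S ≃ₜ T, ∀ z : S, (e z : ℂ) = f (z : ℂ)

/-- `f` is `η`-quasisymmetric on `X`. -/
def QuasisymmetricWith (η : ℝ≥0 ≃ₜ ℝ≥0) (f : ℂ → ℂ) (X : Set ℂ) : Prop :=
  ∀ p ∈ X, ∀ q ∈ X, ∀ s ∈ X, ∀ t : ℝ≥0,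
    dist p q ≤ (t : ℝ) * dist p s → dist (f p) (f q) ≤ (η t : ℝ) * dist (f p) (f s)

/-- `f` is locally quasisymmetric on `X`: its restriction to every compact subset of `X`
is quasisymmetric. -/
def LocallyQuasisymmetricOn (f : ℂ → ℂ) (X : Set ℂ) : Prop :=
  ∀ K ⊆ X, IsCompact K → ∃ η : ℝ≥0 ≃ₜ ℝ≥0, QuasisymmetricWith η f K

/-- `f` is locally bi-Lipschitz on `S`. -/
def LocallyBiLipschitzOn (f : ℂ → ℂ) (S : Set ℂ) : Prop :=
  ∀ p ∈ S, ∃ U ∈ 𝓝[S] p, ∃ L : ℝ, 1 ≤ L ∧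
    ∀ x ∈ U, ∀ y ∈ U,
      dist x y / L ≤ dist (f x) (f y) ∧ dist (f x) (f y) ≤ L * dist x y

/-- The separation condition on the boundary of the target domain: for every boundary
point `pt` of `Ωt` there are indices `i ≠ j` such that `pt` is at distance at least `δ`
from the arc of `∂Ωt` between `q i` and `q j` not containing the third point, where the
arc is a connected component of `∂Ωt` minus the two points. -/
def ArcSeparated (Ωt : Set ℂ) (q : Fin 3 → ℂ) (δ : ℝ) : Prop :=
  ∀ pt ∈ frontier Ωt, ∃ i j : Fin 3, i ≠ j ∧
    ∀ k : Fin 3, k ≠ i → k ≠ j →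
      ∃ x ∈ frontier Ωt \ {q i, q j},
        q k ∉ connectedComponentIn (frontier Ωt \ {q i, q j}) x ∧
        δ ≤ infDist pt (connectedComponentIn (frontier Ωt \ {q i, q j}) x)

theorem IsPreconnected.false_of_finite_pieces {α ι : Type*} [TopologicalSpace α] [Finite ι]
    {P X₀ : Set α} {X : ι → Set α} {f : α → ℝ} {v : ℝ} (hP : IsPreconnected P)
    (h₀ : IsClosed X₀) (hX : ∀ i, IsClosed (X i))
    (hdisj : Pairwise fun i j => Disjoint (X i) (X j)) (hcov : P ⊆ X₀ ∪ ⋃ i, X i)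
    (hf : ContinuousOn f X₀) (hv : ∀ x ∈ P, x ∈ X₀ → f x ≠ v)
    (hside : ∀ i, (∀ x ∈ P, x ∈ X₀ → x ∈ X i → f x < v) ∨
      (∀ x ∈ P, x ∈ X₀ → x ∈ X i → v < f x))
    {a b : α} (ha : a ∈ P) (ha₀ : a ∈ X₀) (hb : b ∈ P) (hb₀ : b ∈ X₀)
    (hav : f a < v) (hvb : v < f b) : False := by
  set T : Set ι := {i | ∀ x ∈ P, x ∈ X₀ → x ∈ X i → f x < v} with hT
  have hU : IsClosed ((X₀ ∩ f ⁻¹' Iic v) ∪ ⋃ i : T, X i) :=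
    (hf.preimage_isClosed_of_isClosed h₀ isClosed_Iic).union
      (isClosed_iUnion_of_finite fun i => hX i)
  have hV : IsClosed ((X₀ ∩ f ⁻¹' Ici v) ∪ ⋃ i : (Tᶜ : Set ι), X i) :=
    (hf.preimage_isClosed_of_isClosed h₀ isClosed_Ici).union
      (isClosed_iUnion_of_finite fun i => hX i)
  obtain ⟨x, hxP, hxU, hxV⟩ := isPreconnected_closed_iff.1 hP _ _ hU hV
    (fun x hx => by
      rcases hcov hx with h | h
      · rcases le_total (f x) v with h' | h'
        · exact Or.inl (Or.inl ⟨h, h'⟩)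
        · exact Or.inr (Or.inl ⟨h, h'⟩)
      · obtain ⟨i, hi⟩ := mem_iUnion.1 h
        by_cases hiT : i ∈ T
        · exact Or.inl (Or.inr (mem_iUnion.2 ⟨⟨i, hiT⟩, hi⟩))
        · exact Or.inr (Or.inr (mem_iUnion.2 ⟨⟨i, hiT⟩, hi⟩)))
    ⟨a, ha, Or.inl ⟨ha₀, hav.le⟩⟩ ⟨b, hb, Or.inl ⟨hb₀, hvb.le⟩⟩
  rcases hxU with ⟨hx₀, hx₁⟩ | hx₁ <;> rcases hxV with ⟨hx₂, hx₃⟩ | hx₃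
  · exact hv x hxP hx₀ (le_antisymm hx₁ hx₃)
  · obtain ⟨⟨i, hi⟩, hxi⟩ := mem_iUnion.1 hx₃
    rcases hside i with h | h
    · exact hi h
    · exact absurd (h x hxP hx₀ hxi) (not_lt.2 hx₁)
  · obtain ⟨⟨i, hi⟩, hxi⟩ := mem_iUnion.1 hx₁
    exact absurd (hi x hxP hx₂ hxi) (not_lt.2 hx₃)
  · obtain ⟨⟨i, hi⟩, hxi⟩ := mem_iUnion.1 hx₁
    obtain ⟨⟨j, hj⟩, hxj⟩ := mem_iUnion.1 hx₃
    have hij : i ≠ j := fun h => hj (h ▸ hi)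
    exact Set.disjoint_left.1 (hdisj hij) hxi hxj

theorem exists_gap_of_finset {I : Type*} (r d : I → ℝ)
    (hd : ∀ τ > 0, ∃ e > 0, ∀ i, τ ≤ r i → e ≤ d i) (N : ℕ) :
    ∀ s > 0, ∃ l > 0, ∀ L : Finset I, L.card ≤ N → ∃ G T : Finset I,
      (∀ i ∈ L, i ∈ G ∨ i ∈ T) ∧ ∑ i ∈ T, 2 * r i + l < s ∧
      ∀ j ∈ G, ∑ i ∈ T, 2 * r i + l < d j := by
  classical
  induction N with
  | zero =>
    intro s hs
    refine ⟨s / 2, by positivity, fun L hL => ⟨∅, ∅, ?_, ?_, ?_⟩⟩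
    · simp_all
    · simpa using hs
    · simp
  | succ N ih =>
    intro s hs
    obtain ⟨e, he, hde⟩ := hd (s / (4 * (N + 1))) (by positivity)
    obtain ⟨l, hl, H⟩ := ih (min s e) (lt_min hs he)
    refine ⟨min l (s / 4), lt_min hl (by positivity), fun L hL => ?_⟩
    by_cases hbig : ∃ j ∈ L, s / (4 * (N + 1)) ≤ r j
    · obtain ⟨j, hjL, hj⟩ := hbig
      obtain ⟨G, T, hGT, hs', hG⟩ := H (L.erase j) (by
        rw [Finset.card_erase_of_mem hjL]; omega)
      have hmin := min_le_left l (s / 4)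
      refine ⟨insert j G, T, fun i hi => ?_, ?_, fun i hi => ?_⟩
      · by_cases hij : i = j
        · simp [hij]
        · have := hGT i (Finset.mem_erase.2 ⟨hij, hi⟩)
          simp only [Finset.mem_insert]
          tauto
      · linarith [min_le_left s e]
      · rcases Finset.mem_insert.1 hi with rfl | hi
        · linarith [min_le_right s e, hde _ hj]
        · linarith [hG i hi]
    · push Not at hbig
      refine ⟨∅, L, by simp, ?_, by simp⟩
      have h1 : ∑ i ∈ L, 2 * r i ≤ L.card • (2 * (s / (4 * (N + 1)))) :=
        Finset.sum_le_card_nsmul _ _ _ fun i hi => by linarith [hbig i hi]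
      have h2 : (L.card : ℝ) ≤ N + 1 := by exact_mod_cast hL
      have h3 : (L.card : ℝ) * (2 * (s / (4 * (N + 1)))) ≤ (N + 1) * (2 * (s / (4 * (N + 1)))) :=
        mul_le_mul_of_nonneg_right h2 (by positivity)
      have h4 : ((N : ℝ) + 1) * (2 * (s / (4 * (N + 1)))) = s / 2 := by
        field_simp; norm_num
      rw [nsmul_eq_mul] at h1
      linarith [min_le_right l (s / 4)]

/-- The complement in `Ω` of a family of closed discs. -/
def circleDomain {J : Type*} (Ω : Set ℂ) (c : J → ℂ) (r : J → ℝ) : Set ℂ :=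
  Ω \ ⋃ j, closedBall (c j) (r j)

section CircleDomain

variable {J : Type*} {Ω : Set ℂ} {c : J → ℂ} {r : J → ℝ}

theorem circleDomain_subset : circleDomain Ω c r ⊆ Ω := sdiff_subset

theorem isOpen_circleDomain [Finite J] (hΩ : IsOpen Ω) : IsOpen (circleDomain Ω c r) :=
  hΩ.sdiff (isClosed_iUnion_of_finite fun _ => isClosed_closedBall)

theorem notMem_closedBall_of_mem_circleDomain {z : ℂ} (hz : z ∈ circleDomain Ω c r) (j : J) :
    z ∉ closedBall (c j) (r j) := fun h => hz.2 (mem_iUnion.2 ⟨j, h⟩)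

theorem notMem_ball_of_mem_closure_circleDomain {z : ℂ} (hz : z ∈ closure (circleDomain Ω c r))
    (j : J) : z ∉ ball (c j) (r j) := by
  have h : closure (circleDomain Ω c r) ⊆ (ball (c j) (r j))ᶜ :=
    closure_minimal (fun w hw hb => notMem_closedBall_of_mem_circleDomain hw j
      (ball_subset_closedBall hb)) isOpen_ball.isClosed_compl
  exact h hz

theorem mem_sphere_of_mem_closure_circleDomain {z : ℂ}
    (hz : z ∈ closure (circleDomain Ω c r)) {j : J} (hj : z ∈ closedBall (c j) (r j)) :
    z ∈ sphere (c j) (r j) :=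
  le_antisymm hj (not_lt.1 (notMem_ball_of_mem_closure_circleDomain hz j))

theorem closure_circleDomain_cases (hΩ : IsOpen Ω) {z : ℂ}
    (hz : z ∈ closure (circleDomain Ω c r)) :
    z ∈ circleDomain Ω c r ∨ z ∈ frontier Ω ∨ ∃ j, z ∈ sphere (c j) (r j) := by
  by_cases h : z ∈ Ω
  · by_cases h' : ∃ j, z ∈ closedBall (c j) (r j)
    · obtain ⟨j, hj⟩ := h'
      exact Or.inr (Or.inr ⟨j, mem_sphere_of_mem_closure_circleDomain hz hj⟩)
    · exact Or.inl ⟨h, fun h'' => h' (mem_iUnion.1 h'')⟩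
  · refine Or.inr (Or.inl ?_)
    rw [hΩ.frontier_eq]
    exact ⟨closure_mono circleDomain_subset hz, h⟩

theorem frontier_subset_closure_circleDomain [Finite J] (hΩ : IsOpen Ω)
    (hc : ∀ j, closedBall (c j) (r j) ⊆ Ω) : frontier Ω ⊆ closure (circleDomain Ω c r) := by
  intro z hz
  rw [hΩ.frontier_eq] at hz
  refine closure_sdiff ⟨hz.1, fun h => ?_⟩
  rw [(isClosed_iUnion_of_finite fun _ => isClosed_closedBall).closure_eq] at h
  obtain ⟨j, hj⟩ := mem_iUnion.1 h
  exact hz.2 (hc j hj)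

theorem sphere_subset_closure_circleDomain [Finite J] (hΩ : IsOpen Ω)
    (hfam : IsSchottkyFamily Ω c r) (j : J) :
    sphere (c j) (r j) ⊆ closure (circleDomain Ω c r) := by
  intro z hz
  have hU : IsOpen (Ω \ ⋃ k : {k // k ≠ j}, closedBall (c k) (r k)) :=
    hΩ.sdiff (isClosed_iUnion_of_finite fun _ => isClosed_closedBall)
  have hzU : z ∈ Ω \ ⋃ k : {k // k ≠ j}, closedBall (c k) (r k) := by
    refine ⟨hfam.2.1 j (sphere_subset_closedBall hz), fun h => ?_⟩
    obtain ⟨k, hk⟩ := mem_iUnion.1 h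
    exact Set.disjoint_left.1 (hfam.2.2 k.2) hk (sphere_subset_closedBall hz)
  have hzc : z ∈ closure (closedBall (c j) (r j))ᶜ := by
    rw [closure_compl, interior_closedBall _ (hfam.1 j).ne']
    exact fun h => (mem_ball.1 h).ne hz
  refine closure_mono ?_ (hU.inter_closure ⟨hzU, hzc⟩)
  rintro w ⟨⟨hw, hw'⟩, hwj⟩
  refine ⟨hw, fun h => ?_⟩
  obtain ⟨k, hk⟩ := mem_iUnion.1 h
  by_cases hkj : k = j
  · exact hwj (hkj ▸ hk)
  · exact hw' (mem_iUnion.2 ⟨⟨k, hkj⟩, hk⟩)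

theorem closure_subset_closure_circleDomain_union [Finite J] (hΩ : IsOpen Ω)
    (hfam : IsSchottkyFamily Ω c r) :
    closure Ω ⊆ closure (circleDomain Ω c r) ∪ ⋃ j, ball (c j) (r j) := by
  intro z hz
  by_cases h : z ∈ Ω
  · by_cases h' : ∃ j, z ∈ closedBall (c j) (r j)
    · obtain ⟨j, hj⟩ := h'
      rcases (mem_closedBall.1 hj).lt_or_eq with h'' | h''
      · exact Or.inr (mem_iUnion.2 ⟨j, h''⟩)
      · exact Or.inl (sphere_subset_closure_circleDomain hΩ hfam j h'')
    · exact Or.inl (subset_closure ⟨h, fun h'' => h' (mem_iUnion.1 h'')⟩)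
  · refine Or.inl (frontier_subset_closure_circleDomain hΩ hfam.2.1 ?_)
    rw [hΩ.frontier_eq]
    exact ⟨hz, h⟩

end CircleDomain

theorem IsSchottkyFamily.finite_le_radius {I : Type*} {Ω : Set ℂ} {c : I → ℂ} {r : I → ℝ}
    (hΩ : Bornology.IsBounded Ω) (h : IsSchottkyFamily Ω c r) {τ : ℝ} (hτ : 0 < τ) :
    {i | τ ≤ r i}.Finite := by
  have hv : 0 < volume (ball (0 : ℂ) τ) := measure_ball_pos _ _ hτ
  refine (Measure.finite_const_le_meas_of_disjoint_iUnion volume hv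
    (As := fun i => closedBall (c i) (r i)) (fun i => isClosed_closedBall.measurableSet)
    h.2.2 ?_).subset fun i hi => ?_
  · exact measure_ne_top_of_subset (iUnion_subset h.2.1) hΩ.measure_lt_top.ne
  · calc volume (ball (0 : ℂ) τ) = volume (ball (c i) τ) := by simp
      _ ≤ _ := measure_mono (ball_subset_closedBall.trans (closedBall_subset_closedBall hi))

theorem infDist_frontier_sub_radius_pos {Ω : Set ℂ} (hΩ : IsOpen Ω)
    (hne : (frontier Ω).Nonempty) {c : ℂ} {r : ℝ} (h : closedBall c r ⊆ Ω) :
    0 < infDist c (frontier Ω) - r := by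
  obtain ⟨z, hz, hzd⟩ := isClosed_frontier.exists_infDist_eq_dist hne c
  by_contra hcon
  have : z ∈ Ω := h (by rw [mem_closedBall, dist_comm, ← hzd]; linarith)
  rw [hΩ.frontier_eq] at hz
  exact hz.2 this

theorem IsSchottkyFamily.exists_le_infDist_sub_radius {I : Type*} {Ω : Set ℂ} {c : I → ℂ}
    {r : I → ℝ} (hΩ : IsOpen Ω) (hb : Bornology.IsBounded Ω) (hne : (frontier Ω).Nonempty)
    (h : IsSchottkyFamily Ω c r) {τ : ℝ} (hτ : 0 < τ) :
    ∃ e > 0, ∀ i, τ ≤ r i → e ≤ infDist (c i) (frontier Ω) - r i := by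
  by_cases hem : {i | τ ≤ r i}.Nonempty
  · obtain ⟨j, -, hmin⟩ := (h.finite_le_radius hb hτ).exists_minimalFor
      (fun i => infDist (c i) (frontier Ω) - r i) _ hem
    refine ⟨_, infDist_frontier_sub_radius_pos hΩ hne (h.2.1 j), fun i hi => ?_⟩
    rcases le_total (infDist (c j) (frontier Ω) - r j) (infDist (c i) (frontier Ω) - r i) with
      h' | h'
    · exact h'
    · exact hmin hi h'
  · exact ⟨1, one_pos, fun i hi => (hem ⟨i, hi⟩).elim⟩

theorem infDist_sub_radius_le_dist {F : Set ℂ} {c x z : ℂ} {r : ℝ} (hx : x ∈ closedBall c r)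
    (hz : z ∈ F) : infDist c F - r ≤ dist x z := by
  have h1 := infDist_le_dist_of_mem (x := c) hz
  have h2 := dist_triangle c x z
  rw [mem_closedBall, dist_comm] at hx
  linarith

theorem IsHomeoOn.exists_inverse {f : ℂ → ℂ} {S T : Set ℂ} (hf : IsHomeoOn f S T) :
    MapsTo f S T ∧ ContinuousOn f S ∧ ∃ h : ℂ → ℂ, MapsTo h T S ∧ ContinuousOn h T ∧
      (∀ x ∈ S, h (f x) = x) ∧ ∀ y ∈ T, f (h y) = y := by
  classical
  obtain ⟨e, he⟩ := hf
  have hmaps : MapsTo f S T := fun x hx => by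
    rw [← he ⟨x, hx⟩]
    exact (e ⟨x, hx⟩).2
  refine ⟨hmaps, ?_, fun y => if hy : y ∈ T then (e.symm ⟨y, hy⟩ : ℂ) else 0, ?_, ?_, ?_, ?_⟩
  · rw [continuousOn_iff_continuous_domRestrict]
    exact (continuous_subtype_val.comp e.continuous).congr he
  · intro y hy
    simp [hy]
  · rw [continuousOn_iff_continuous_domRestrict]
    exact (continuous_subtype_val.comp e.symm.continuous).congr fun y => by simp
  · intro x hx
    have h1 : e ⟨x, hx⟩ = ⟨f x, hmaps hx⟩ := Subtype.ext (he ⟨x, hx⟩)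
    simp [hmaps hx, ← h1]
  · intro y hy
    simp [hy, ← he]

/-- The data carried by the inverse `h` of a conformal map onto the relative circle domain
`circleDomain Ωt ct rt`: the disc with index `j` in the target corresponds to the disc with
index `σ j` in the source. -/
structure IsCircleDomainInverse {I J : Type*} (Ω : Set ℂ) (c : I → ℂ) (r : I → ℝ) (Ωt : Set ℂ)
    (ct : J → ℂ) (rt : J → ℝ) (h : ℂ → ℂ) (σ : J → I) : Prop where
  continuousOn : ContinuousOn h (closure (circleDomain Ωt ct rt))
  differentiableOn : DifferentiableOn ℂ h (circleDomain Ωt ct rt)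
  injOn : InjOn h (circleDomain Ωt ct rt)
  mapsTo : MapsTo h (circleDomain Ωt ct rt) Ω
  notMem : ∀ w ∈ circleDomain Ωt ct rt, ∀ j, h w ∉ closedBall (c (σ j)) (r (σ j))
  mapsTo_sphere : ∀ j, MapsTo h (sphere (ct j) (rt j)) (closedBall (c (σ j)) (r (σ j)))
  mapsTo_frontier : MapsTo h (frontier Ωt) (frontier Ω)
  injective : Function.Injective σ

theorem exists_isCircleDomainInverse {I J : Type*} [Finite I] [Finite J] {Ω Ωt : Set ℂ}
    {c : I → ℂ} {r : I → ℝ} {ct : J → ℂ} {rt : J → ℝ} {g h : ℂ → ℂ} (hΩ : IsOpen Ω)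
    (hΩt : IsOpen Ωt) (hfam : IsSchottkyFamily Ω c r) (hfamt : IsSchottkyFamily Ωt ct rt)
    (hg : MapsTo g (closure (circleDomain Ω c r)) (closure (circleDomain Ωt ct rt)))
    (hh : MapsTo h (closure (circleDomain Ωt ct rt)) (closure (circleDomain Ω c r)))
    (hcont : ContinuousOn h (closure (circleDomain Ωt ct rt)))
    (hhg : ∀ x ∈ closure (circleDomain Ω c r), h (g x) = x)
    (hgh : ∀ w ∈ closure (circleDomain Ωt ct rt), g (h w) = w)
    (hdiff : DifferentiableOn ℂ g (circleDomain Ω c r))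
    (hderiv : ∀ z ∈ circleDomain Ω c r, deriv g z ≠ 0)
    (hfr : g '' frontier Ω = frontier Ωt)
    (hsph : ∀ i, ∃ j, g '' sphere (c i) (r i) = sphere (ct j) (rt j)) :
    ∃ σ : J → I, IsCircleDomainInverse Ω c r Ωt ct rt h σ ∧ Function.Surjective σ ∧
      ∀ j, g '' sphere (c (σ j)) (r (σ j)) = sphere (ct j) (rt j) := by
  have hA : IsOpen (circleDomain Ω c r) := isOpen_circleDomain hΩ
  have hAt : IsOpen (circleDomain Ωt ct rt) := isOpen_circleDomain hΩt
  have huniq : ∀ {w : ℂ} {j k : J}, w ∈ closedBall (ct j) (rt j) →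
      w ∈ closedBall (ct k) (rt k) → j = k := fun {w j k} hj hk => by
    by_contra hjk
    exact Set.disjoint_left.1 (hfamt.2.2 hjk) hj hk
  have hne : ∀ j, (sphere (ct j) (rt j)).Nonempty := fun j =>
    (NormedSpace.sphere_nonempty).2 (hfamt.1 j).le
  have hexists : ∀ j, ∃ i, g '' sphere (c i) (r i) = sphere (ct j) (rt j) := by
    intro j
    obtain ⟨w, hw⟩ := hne j
    have hwcl := sphere_subset_closure_circleDomain hΩt hfamt j hw
    rcases closure_circleDomain_cases hΩ (hh hwcl) with ha | hf | ⟨i, hi⟩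
    · exfalso
      have hst : HasStrictDerivAt g (deriv g (h w)) (h w) :=
        ((hdiff.analyticAt (hA.mem_nhds ha)).hasStrictDerivAt)
      have hmap := hst.map_nhds_eq (hderiv _ ha)
      rw [hgh w hwcl] at hmap
      have himg : g '' circleDomain Ω c r ∈ 𝓝 w := hmap ▸ image_mem_map (hA.mem_nhds ha)
      have hwb : w ∈ closure (ball (ct j) (rt j)) := by
        rw [closure_ball _ (hfamt.1 j).ne']
        exact sphere_subset_closedBall hw
      obtain ⟨v, ⟨a, ha', rfl⟩, hv⟩ := mem_closure_iff_nhds.1 hwb _ himg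
      exact notMem_ball_of_mem_closure_circleDomain (hg (subset_closure ha')) j hv
    · exfalso
      have : w ∈ frontier Ωt := hfr ▸ ⟨h w, hf, hgh w hwcl⟩
      rw [hΩt.frontier_eq] at this
      exact this.2 (hfamt.2.1 j (sphere_subset_closedBall hw))
    · obtain ⟨k, hk⟩ := hsph i
      have hwk : w ∈ sphere (ct k) (rt k) := hk ▸ ⟨h w, hi, hgh w hwcl⟩
      exact ⟨i, by rw [hk, huniq (sphere_subset_closedBall hw) (sphere_subset_closedBall hwk)]⟩
  choose σ hσ using hexists
  have hhsph : ∀ j, MapsTo h (sphere (ct j) (rt j)) (sphere (c (σ j)) (r (σ j))) := by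
    intro j w hw
    rw [← hσ j] at hw
    obtain ⟨x, hx, rfl⟩ := hw
    rwa [hhg x (sphere_subset_closure_circleDomain hΩ hfam _ hx)]
  have hAtA : MapsTo h (circleDomain Ωt ct rt) (circleDomain Ω c r) := by
    intro w hw
    have hwcl := subset_closure hw
    rcases closure_circleDomain_cases hΩ (hh hwcl) with ha | hf | ⟨i, hi⟩
    · exact ha
    · exfalso
      have : w ∈ frontier Ωt := hfr ▸ ⟨h w, hf, hgh w hwcl⟩
      rw [hΩt.frontier_eq] at this
      exact this.2 hw.1
    · exfalso
      obtain ⟨k, hk⟩ := hsph i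
      have hwk : w ∈ sphere (ct k) (rt k) := hk ▸ ⟨h w, hi, hgh w hwcl⟩
      exact notMem_closedBall_of_mem_circleDomain hw k (sphere_subset_closedBall hwk)
  refine ⟨σ, ⟨hcont, fun w hw => ?_, fun w hw v hv hwv => ?_, fun w hw => (hAtA hw).1,
    fun w hw j => notMem_closedBall_of_mem_circleDomain (hAtA hw) (σ j),
    fun j => (hhsph j).mono_right sphere_subset_closedBall, fun w hw => ?_, fun j k hjk => ?_⟩,
    fun i => ?_, hσ⟩
  · have hd : HasDerivAt g (deriv g (h w)) (h w) :=
      (hdiff.differentiableAt (hA.mem_nhds (hAtA hw))).hasDerivAt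
    exact (hd.of_local_left_inverse
      (hcont.continuousAt (mem_of_superset (hAt.mem_nhds hw) subset_closure))
      (hderiv _ (hAtA hw)) (eventually_of_mem (hAt.mem_nhds hw)
        fun v hv => hgh v (subset_closure hv))).differentiableAt.differentiableWithinAt
  · rw [← hgh w (subset_closure hw), hwv, hgh v (subset_closure hv)]
  · rw [← hfr] at hw
    obtain ⟨x, hx, rfl⟩ := hw
    rwa [hhg x (frontier_subset_closure_circleDomain hΩ hfam.2.1 hx)]
  · obtain ⟨w, hw⟩ := hne j
    have hw' := hw
    rw [← hσ j, hjk, hσ k] at hw'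
    exact huniq (sphere_subset_closedBall hw) (sphere_subset_closedBall hw')
  · obtain ⟨j, hj⟩ := hsph i
    refine ⟨j, ?_⟩
    by_contra hne'
    obtain ⟨w, hw⟩ := hne j
    have h1 : h w ∈ sphere (c i) (r i) := by
      rw [← hj] at hw
      obtain ⟨x, hx, rfl⟩ := hw
      rwa [hhg x (sphere_subset_closure_circleDomain hΩ hfam _ hx)]
    exact Set.disjoint_left.1 (hfam.2.2 hne') (sphere_subset_closedBall (hhsph j hw))
      (sphere_subset_closedBall h1)

theorem volume_image_closedBall_le {u : StrongDual ℝ ℂ} (hu : ‖u‖ ≤ 1) (c : ℂ) (r : ℝ) :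
    volume (u '' closedBall c r) ≤ ENNReal.ofReal (2 * r) := by
  rw [← Real.volume_closedBall (u c) r]
  refine measure_mono ?_
  rintro _ ⟨x, hx, rfl⟩
  rw [mem_closedBall, dist_eq_norm] at hx ⊢
  rw [← map_sub]
  exact ((u.le_of_opNorm_le hu _).trans_eq (one_mul _)).trans hx

/-- The image under `h` of an arc crossing a finite number of discs: the displacement is at most
the length of the image of the part of the arc in the circle domain plus the diameters of the
discs corresponding to those which are crossed. -/
theorem IsCircleDomainInverse.dist_le_of_arc {I J : Type*} [Finite J] {Ω Ωt : Set ℂ}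
    {c : I → ℂ} {r : I → ℝ} {ct : J → ℂ} {rt : J → ℝ} {h : ℂ → ℂ} {σ : J → I}
    (H : IsCircleDomainInverse Ω c r Ωt ct rt h σ) (hΩt : IsOpen Ωt)
    (hfamt : IsSchottkyFamily Ωt ct rt) (hr : ∀ i, 0 < r i) {κ : ℝ → ℂ} (hκ : Continuous κ)
    {Z : Set ℂ} (hZ : ∀ θ, κ θ ∈ Z) {a b : ℝ} (hab : a ≤ b)
    (ha : κ a ∈ closure (circleDomain Ωt ct rt)) (hb : κ b ∈ closure (circleDomain Ωt ct rt))
    (hmid : ∀ θ ∈ Ioo a b, κ θ ∈ Ωt) {T : Finset I}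
    (hT : ∀ θ ∈ Ioc a b, ∀ j, κ θ ∈ closedBall (ct j) (rt j) → σ j ∈ T) {l : ℝ} (hl : 0 ≤ l)
    (hlen : ∀ u : StrongDual ℝ ℂ, ‖u‖ ≤ 1 →
      volume (u '' (h '' (circleDomain Ωt ct rt ∩ Z))) ≤ ENNReal.ofReal l) :
    dist (h (κ a)) (h (κ b)) ≤ l + ∑ i ∈ T, 2 * r i := by
  obtain ⟨u, hu, hux⟩ := exists_dual_vector'' ℝ (h (κ b) - h (κ a))
  rw [map_sub] at hux
  have hsum : 0 ≤ ∑ i ∈ T, 2 * r i := Finset.sum_nonneg fun i _ => by linarith [hr i]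
  have hcover : Ioo (u (h (κ a))) (u (h (κ b))) ⊆
      u '' (h '' (circleDomain Ωt ct rt ∩ Z)) ∪ ⋃ i ∈ T, u '' closedBall (c i) (r i) := by
    intro v hv
    by_contra hcon
    rw [mem_union, not_or] at hcon
    obtain ⟨hv1, hv2⟩ := hcon
    have hball : ∀ i ∈ T, v ∉ u '' closedBall (c i) (r i) := fun i hi hvi =>
      hv2 (mem_iUnion₂.2 ⟨i, hi, hvi⟩)
    have hvals : ∀ θ ∈ Icc a b, κ θ ∈ closure (circleDomain Ωt ct rt) →
        u (h (κ θ)) ≠ v := by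
      intro θ hθ hθcl hθv
      have hθa : a < θ := lt_of_le_of_ne hθ.1 fun h' => by
        subst h'
        exact hv.1.ne hθv
      have hθb : θ < b := lt_of_le_of_ne hθ.2 fun h' => by
        subst h'
        exact hv.2.ne' hθv
      rcases closure_circleDomain_cases hΩt hθcl with hA | hf | ⟨j, hj⟩
      · exact hv1 ⟨_, ⟨_, ⟨hA, hZ θ⟩, rfl⟩, hθv⟩
      · rw [hΩt.frontier_eq] at hf
        exact hf.2 (hmid θ ⟨hθa, hθb⟩)
      · exact hball _ (hT θ ⟨hθa, hθb.le⟩ j (sphere_subset_closedBall hj))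
          ⟨_, H.mapsTo_sphere j hj, hθv⟩
    refine isPreconnected_Icc.false_of_finite_pieces (P := Icc a b)
      (X₀ := κ ⁻¹' closure (circleDomain Ωt ct rt))
      (X := fun j => κ ⁻¹' closedBall (ct j) (rt j)) (f := fun θ => u (h (κ θ)))
      (isClosed_closure.preimage hκ) (fun j => isClosed_closedBall.preimage hκ)
      (fun i j hij => (hfamt.2.2 hij).preimage κ) (fun θ hθ => ?_)
      (u.continuous.comp_continuousOn (H.continuousOn.comp hκ.continuousOn fun θ hθ => hθ))
      hvals (fun j => ?_) (left_mem_Icc.2 hab) ha (right_mem_Icc.2 hab) hb hv.1 hv.2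
    · rcases eq_or_lt_of_le hθ.1 with rfl | h1
      · exact Or.inl ha
      rcases eq_or_lt_of_le hθ.2 with rfl | h2
      · exact Or.inl hb
      rcases closure_subset_closure_circleDomain_union hΩt hfamt
        (subset_closure (hmid θ ⟨h1, h2⟩)) with h' | h'
      · exact Or.inl h'
      · obtain ⟨j, hj⟩ := mem_iUnion.1 h'
        exact Or.inr (mem_iUnion.2 ⟨j, ball_subset_closedBall hj⟩)
    · by_cases hj : ∃ θ ∈ Ioc a b, κ θ ∈ closedBall (ct j) (rt j)
      · obtain ⟨θ, hθ, hθj⟩ := hj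
        have hvj := hball _ (hT θ hθ j hθj)
        have hpre : OrdConnected (u '' closedBall (c (σ j)) (r (σ j))) :=
          ((convex_closedBall _ _).isPreconnected.image _ u.continuous.continuousOn).ordConnected
        have hside : ∀ x ∈ u '' closedBall (c (σ j)) (r (σ j)), x ≠ v := fun x hx hxv =>
          hvj (hxv ▸ hx)
        have hmem : ∀ θ, κ θ ∈ closure (circleDomain Ωt ct rt) →
            κ θ ∈ closedBall (ct j) (rt j) →
            u (h (κ θ)) ∈ u '' closedBall (c (σ j)) (r (σ j)) := fun θ h₀ h₁ =>
          ⟨_, H.mapsTo_sphere j (mem_sphere_of_mem_closure_circleDomain h₀ h₁), rfl⟩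
        by_cases hlt : ∃ x ∈ u '' closedBall (c (σ j)) (r (σ j)), x < v
        · obtain ⟨x, hx, hxv⟩ := hlt
          refine Or.inl fun θ' _ h₀ h₁ => ?_
          by_contra hge
          exact hvj (hpre.out hx (hmem θ' h₀ h₁) ⟨hxv.le, not_lt.1 hge⟩)
        · push Not at hlt
          exact Or.inr fun θ' _ h₀ h₁ =>
            lt_of_le_of_ne (hlt _ (hmem θ' h₀ h₁)) (hside _ (hmem θ' h₀ h₁)).symm
      · push Not at hj
        refine Or.inl fun θ hθ _ hθj => ?_
        rcases eq_or_lt_of_le hθ.1 with rfl | h1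
        · exact hv.1
        · exact absurd hθj (hj θ ⟨h1, hθ.2⟩)
  have hvol : ENNReal.ofReal (dist (h (κ a)) (h (κ b))) ≤
      ENNReal.ofReal (l + ∑ i ∈ T, 2 * r i) := by
    calc ENNReal.ofReal (dist (h (κ a)) (h (κ b)))
        = volume (Ioo (u (h (κ a))) (u (h (κ b)))) := by
          rw [Real.volume_Ioo, hux, dist_comm, dist_eq_norm]
          simp
      _ ≤ volume (u '' (h '' (circleDomain Ωt ct rt ∩ Z))) +
          ∑ i ∈ T, volume (u '' closedBall (c i) (r i)) :=
          (measure_mono hcover).trans ((measure_union_le _ _).trans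
            (add_le_add_right (measure_biUnion_finset_le _ _) _))
      _ ≤ ENNReal.ofReal l + ∑ i ∈ T, ENNReal.ofReal (2 * r i) :=
          add_le_add (hlen u hu) (Finset.sum_le_sum fun i _ => volume_image_closedBall_le hu _ _)
      _ = _ := by
          rw [← ENNReal.ofReal_sum_of_nonneg fun i _ => by linarith [hr i],
            ENNReal.ofReal_add hl hsum]
  exact (ENNReal.ofReal_le_ofReal_iff (by positivity)).1 hvol

open Complex in
/-- The length of the image under `h` of the part of the circle of radius `exp t` around `p` which
lies in `D`. -/
def circleImageLength (h : ℂ → ℂ) (p : ℂ) (D : Set ℂ) (t : ℝ) : ℝ≥0∞ :=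
  ∫⁻ θ in Ioc (-Real.pi) Real.pi,
    {ζ : ℂ | p + exp ζ ∈ D}.indicator (fun ζ => ‖deriv (fun ζ => h (p + exp ζ)) ζ‖ₑ) (t + θ * I)

theorem Complex.abs_det_smul_one_restrictScalars (w : ℂ) :
    |((ContinuousLinearMap.toSpanSingleton ℂ w).restrictScalars ℝ).det| = ‖w‖ ^ 2 := by
  simp [ContinuousLinearMap.det, LinearMap.det_restrictScalars, Algebra.norm_complex_eq,
    Complex.normSq_eq_norm_sq]

section LengthArea

variable {h : ℂ → ℂ} {p : ℂ} {D : Set ℂ}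

theorem isOpen_preimage_add_exp (hD : IsOpen D) : IsOpen {ζ : ℂ | p + Complex.exp ζ ∈ D} :=
  hD.preimage (by fun_prop)

theorem hasDerivAt_comp_add_exp (hD : IsOpen D) (hh : DifferentiableOn ℂ h D) {ζ : ℂ}
    (hζ : p + Complex.exp ζ ∈ D) :
    HasDerivAt (fun ζ => h (p + Complex.exp ζ)) (deriv (fun ζ => h (p + Complex.exp ζ)) ζ) ζ := by
  have h1 : DifferentiableAt ℂ h (p + Complex.exp ζ) := hh.differentiableAt (hD.mem_nhds hζ)
  have h2 : DifferentiableAt ℂ (fun ζ => p + Complex.exp ζ) ζ := by fun_prop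
  exact (DifferentiableAt.comp (g := h) ζ h1 h2).hasDerivAt

theorem exists_eq_add_exp {w : ℂ} {t : ℝ} (hw : dist w p = Real.exp t) :
    ∃ θ ∈ Ioc (-Real.pi) Real.pi, w = p + Complex.exp (t + θ * Complex.I) := by
  refine ⟨(w - p).arg, Complex.arg_mem_Ioc _, ?_⟩
  rw [Complex.exp_add, ← Complex.ofReal_exp, ← hw, dist_eq_norm, Complex.norm_mul_exp_arg_mul_I]
  ring

theorem volume_image_circle_le (hD : IsOpen D) (hh : DifferentiableOn ℂ h D) (t : ℝ)
    {u : StrongDual ℝ ℂ} (hu : ‖u‖ ≤ 1) :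
    volume (u '' (h '' (D ∩ sphere p (Real.exp t)))) ≤ circleImageLength h p D t := by
  set q : ℂ → ℂ := fun ζ => h (p + Complex.exp ζ) with hq
  set s : Set ℝ := {θ : ℝ | p + Complex.exp (t + θ * Complex.I) ∈ D} with hs
  have hsm : MeasurableSet s := (hD.preimage (by fun_prop)).measurableSet
  set φ : ℝ → ℝ := fun θ => u (q (t + θ * Complex.I)) with hφ
  have hder : ∀ θ ∈ s ∩ Ioc (-Real.pi) Real.pi, HasDerivWithinAt φ
      (u (deriv q (t + θ * Complex.I) * Complex.I)) (s ∩ Ioc (-Real.pi) Real.pi) θ := by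
    intro θ hθ
    have h1 : HasDerivAt q (deriv q (t + θ * Complex.I)) (t + θ * Complex.I) :=
      hasDerivAt_comp_add_exp hD hh hθ.1
    have h2 : HasDerivAt (fun θ : ℝ => (t + θ * Complex.I : ℂ)) Complex.I θ := by
      simpa using ((Complex.ofRealCLM.hasDerivAt (x := θ)).mul_const Complex.I).const_add (t : ℂ)
    have h3 := h1.comp_of_eq θ h2 rfl
    exact (u.hasFDerivAt.comp_hasDerivAt θ h3).hasDerivWithinAt
  calc volume (u '' (h '' (D ∩ sphere p (Real.exp t))))
      ≤ volume (φ '' (s ∩ Ioc (-Real.pi) Real.pi)) := by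
        refine measure_mono ?_
        rintro _ ⟨_, ⟨w, ⟨hw, hwt⟩, rfl⟩, rfl⟩
        obtain ⟨θ, hθ, rfl⟩ := exists_eq_add_exp hwt
        exact ⟨θ, ⟨hw, hθ⟩, rfl⟩
    _ ≤ ∫⁻ θ in s ∩ Ioc (-Real.pi) Real.pi, ENNReal.ofReal |(ContinuousLinearMap.toSpanSingleton ℝ
          (u (deriv q (t + θ * Complex.I) * Complex.I))).det| :=
        addHaar_image_le_lintegral_abs_det_fderiv volume (hsm.inter measurableSet_Ioc)
          fun θ hθ => (hder θ hθ).hasFDerivWithinAt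
    _ ≤ ∫⁻ θ in s ∩ Ioc (-Real.pi) Real.pi, ‖deriv q (t + θ * Complex.I)‖ₑ := by
        refine lintegral_mono fun θ => ?_
        simp only [ContinuousLinearMap.det_toSpanSingleton]
        rw [← Real.enorm_eq_ofReal_abs]
        refine (ContinuousLinearMap.le_opENorm u _).trans ?_
        rw [enorm_mul]
        have : ‖u‖ₑ ≤ 1 := by
          rw [← ofReal_norm]
          exact ENNReal.ofReal_le_one.2 hu
        calc _ ≤ 1 * (‖deriv q (t + θ * Complex.I)‖ₑ * ‖Complex.I‖ₑ) := by gcongr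
          _ = _ := by simp [← ofReal_norm Complex.I]
    _ = circleImageLength h p D t := by
        rw [← setLIntegral_indicator hsm]
        rfl

theorem lintegral_circleImageLength_le (hD : IsOpen D) (hh : DifferentiableOn ℂ h D)
    (hinj : InjOn h D) (t₀ t₁ : ℝ) {a : ℝ} (ha : 0 < a) :
    ∫⁻ t in Ioo t₀ t₁, circleImageLength h p D t ≤
      ENNReal.ofReal (a * (2 * Real.pi * (t₁ - t₀))) + ENNReal.ofReal a⁻¹ *
        volume (h '' (D ∩ {w | Real.exp t₀ < dist w p ∧ dist w p < Real.exp t₁})) := by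
  set q : ℂ → ℂ := fun ζ => h (p + Complex.exp ζ) with hq
  set G : Set ℂ := {ζ : ℂ | p + Complex.exp ζ ∈ D} with hG
  have hGo : IsOpen G := isOpen_preimage_add_exp hD
  set B : Set (ℝ × ℝ) := Ioo t₀ t₁ ×ˢ Ioc (-Real.pi) Real.pi with hB
  have hBm : MeasurableSet B := measurableSet_Ioo.prod measurableSet_Ioc
  have hmeas : Measurable (G.indicator fun ζ => ‖deriv q ζ‖ₑ) :=
    (measurable_deriv q).enorm.indicator hGo.measurableSet
  have hmeas2 : Measurable (G.indicator fun ζ => ENNReal.ofReal (‖deriv q ζ‖ ^ 2)) :=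
    ((measurable_deriv q).norm.pow_const 2).ennreal_ofReal.indicator hGo.measurableSet
  have hemb : Measurable fun z : ℝ × ℝ => (z.1 + z.2 * Complex.I : ℂ) := by fun_prop
  have hmeas' : Measurable fun z : ℝ × ℝ =>
      G.indicator (fun ζ => ‖deriv q ζ‖ₑ) (z.1 + z.2 * Complex.I) := hmeas.comp hemb
  have hmeas2' : Measurable fun z : ℝ × ℝ =>
      G.indicator (fun ζ => ENNReal.ofReal (‖deriv q ζ‖ ^ 2)) (z.1 + z.2 * Complex.I) :=
    hmeas2.comp hemb
  have hpt : ∀ ζ, G.indicator (fun ζ => ‖deriv q ζ‖ₑ) ζ ≤ ENNReal.ofReal a +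
      ENNReal.ofReal a⁻¹ * G.indicator (fun ζ => ENNReal.ofReal (‖deriv q ζ‖ ^ 2)) ζ := by
    intro ζ
    by_cases hζ : ζ ∈ G
    · simp only [indicator_of_mem hζ]
      rw [← ofReal_norm, ← ENNReal.ofReal_mul (by positivity),
        ← ENNReal.ofReal_add ha.le (by positivity)]
      refine ENNReal.ofReal_le_ofReal ?_
      have : a * (a + a⁻¹ * ‖deriv q ζ‖ ^ 2 - ‖deriv q ζ‖) =
          a ^ 2 + ‖deriv q ζ‖ ^ 2 - a * ‖deriv q ζ‖ := by field_simp
      have h2 : 0 ≤ a * (a + a⁻¹ * ‖deriv q ζ‖ ^ 2 - ‖deriv q ζ‖) := by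
        rw [this]; nlinarith [sq_nonneg (a - ‖deriv q ζ‖), norm_nonneg (deriv q ζ)]
      linarith [nonneg_of_mul_nonneg_right h2 ha]
    · simp [hζ]
  set E : Set ℂ := (Complex.measurableEquivRealProd ⁻¹' B) with hE
  have hEm : MeasurableSet E := Complex.measurableEquivRealProd.measurable hBm
  have hEmem : ∀ ζ ∈ E, ζ.re ∈ Ioo t₀ t₁ ∧ ζ.im ∈ Ioc (-Real.pi) Real.pi := fun ζ hζ => hζ
  have harea : ∫⁻ z in B, G.indicator (fun ζ => ENNReal.ofReal (‖deriv q ζ‖ ^ 2))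
      (z.1 + z.2 * Complex.I) ≤
      volume (h '' (D ∩ {w | Real.exp t₀ < dist w p ∧ dist w p < Real.exp t₁})) := by
    calc ∫⁻ z in B, G.indicator (fun ζ => ENNReal.ofReal (‖deriv q ζ‖ ^ 2))
          (z.1 + z.2 * Complex.I)
        = ∫⁻ ζ in E, G.indicator (fun ζ => ENNReal.ofReal (‖deriv q ζ‖ ^ 2)) ζ := by
          rw [← Complex.volume_preserving_equiv_real_prod.setLIntegral_comp_preimage hBm
            hmeas2']
          refine lintegral_congr fun ζ => ?_
          simp [Complex.measurableEquivRealProd_apply, Complex.re_add_im]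
      _ = ∫⁻ ζ in E ∩ G, ENNReal.ofReal
            |((ContinuousLinearMap.toSpanSingleton ℂ (deriv q ζ)).restrictScalars ℝ).det| := by
          rw [setLIntegral_indicator hGo.measurableSet, inter_comm]
          simp only [Complex.abs_det_smul_one_restrictScalars]
      _ = volume (q '' (E ∩ G)) := by
          refine lintegral_abs_det_fderiv_eq_addHaar_image volume (hEm.inter hGo.measurableSet)
            (fun ζ hζ => ?_) ?_
          · exact ((hasDerivAt_comp_add_exp hD hh hζ.2).hasFDerivAt.restrictScalars
              ℝ).hasFDerivWithinAt
          · intro ζ hζ ξ hξ hζξ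
            have h1 := add_left_cancel (hinj hζ.2 hξ.2 hζξ)
            exact Complex.exp_inj_of_neg_pi_lt_of_le_pi (hEmem _ hζ.1).2.1 (hEmem _ hζ.1).2.2
              (hEmem _ hξ.1).2.1 (hEmem _ hξ.1).2.2 h1
      _ ≤ _ := by
          refine measure_mono ?_
          rintro _ ⟨ζ, ⟨hζE, hζG⟩, rfl⟩
          refine ⟨_, ⟨hζG, ?_⟩, rfl⟩
          have hd : dist (p + Complex.exp ζ) p = Real.exp ζ.re := by
            rw [dist_eq_norm, add_sub_cancel_left, Complex.norm_exp]
          rw [mem_ofPred_eq, hd]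
          exact ⟨Real.exp_lt_exp.2 (hEmem ζ hζE).1.1, Real.exp_lt_exp.2 (hEmem ζ hζE).1.2⟩
  calc ∫⁻ t in Ioo t₀ t₁, circleImageLength h p D t
      = ∫⁻ z in B, G.indicator (fun ζ => ‖deriv q ζ‖ₑ) (z.1 + z.2 * Complex.I) := by
        rw [hB, Measure.volume_eq_prod, ← Measure.prod_restrict,
          lintegral_prod _ hmeas'.aemeasurable]
        rfl
    _ ≤ ∫⁻ z in B, (ENNReal.ofReal a + ENNReal.ofReal a⁻¹ *
          G.indicator (fun ζ => ENNReal.ofReal (‖deriv q ζ‖ ^ 2)) (z.1 + z.2 * Complex.I)) :=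
        lintegral_mono fun z => hpt _
    _ = ENNReal.ofReal a * volume B + ENNReal.ofReal a⁻¹ * ∫⁻ z in B,
          G.indicator (fun ζ => ENNReal.ofReal (‖deriv q ζ‖ ^ 2)) (z.1 + z.2 * Complex.I) := by
        rw [lintegral_add_left measurable_const, setLIntegral_const,
          lintegral_const_mul _ hmeas2']
    _ ≤ _ := by
        refine add_le_add (le_of_eq ?_) (by gcongr)
        rw [hB, Measure.volume_eq_prod, Measure.prod_prod, Real.volume_Ioo, Real.volume_Ioc,
          ENNReal.ofReal_mul ha.le, mul_comm (ENNReal.ofReal (t₁ - t₀)),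
          ← ENNReal.ofReal_mul (by linarith [Real.pi_pos])]
        congr 3
        ring

end LengthArea

theorem sum_sq_radius_le {ι : Type*} (F : Finset ι) {c : ι → ℂ} {r : ι → ℝ} {x : ℂ} {ρ : ℝ}
    (hr : ∀ i ∈ F, 0 ≤ r i) (hρ : 0 ≤ ρ) (hsub : ∀ i ∈ F, ball (c i) (r i) ⊆ ball x ρ)
    (hd : (F : Set ι).PairwiseDisjoint fun i => ball (c i) (r i)) :
    ∑ i ∈ F, r i ^ 2 ≤ ρ ^ 2 := by
  have h1 : ∑ i ∈ F, volume (ball (c i) (r i)) ≤ volume (ball x ρ) := by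
    rw [← measure_biUnion_finset hd fun i _ => measurableSet_ball]
    exact measure_mono (iUnion₂_subset hsub)
  simp only [Complex.volume_ball] at h1
  rw [← Finset.sum_mul, ENNReal.mul_le_mul_iff_left (by simpa using NNReal.pi_ne_zero) (by simp),
    Finset.sum_congr rfl fun i hi => (ENNReal.ofReal_pow (hr i hi) 2).symm,
    ← ENNReal.ofReal_sum_of_nonneg fun i _ => sq_nonneg _, ← ENNReal.ofReal_pow hρ] at h1
  exact (ENNReal.ofReal_le_ofReal_iff (sq_nonneg _)).1 h1

theorem exists_mul_measure_le {α : Type*} [MeasurableSpace α] {μ : Measure α} {U : Set α} {n : ℕ}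
    (hn : 0 < n) {D : Fin n → Set α} (hm : ∀ k, MeasurableSet (D k)) (hU : ∀ k, D k ⊆ U)
    (hd : Pairwise fun k l => Disjoint (D k) (D l)) : ∃ k, n * μ (D k) ≤ μ U := by
  by_contra! hcon
  have : NeZero n := ⟨hn.ne'⟩
  have h1 : ∑ k, μ (D k) ≤ μ U := by
    rw [← tsum_fintype (L := .unconditional _), ← measure_iUnion hd hm]
    exact measure_mono (iUnion_subset hU)
  obtain ⟨k, -, hk⟩ := Finset.exists_min_image Finset.univ (fun k => μ (D k)) Finset.univ_nonempty
  refine (hcon k).not_ge (le_trans ?_ h1)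
  calc (n : ℝ≥0∞) * μ (D k) = ∑ _l : Fin n, μ (D k) := by simp
    _ ≤ _ := Finset.sum_le_sum fun l hl => hk l hl

namespace IsCircleDomainInverse

variable {I J : Type*} [Finite J] {Ω Ωt : Set ℂ} {c : I → ℂ} {r : I → ℝ} {ct : J → ℂ} {rt : J → ℝ}
  {h : ℂ → ℂ} {σ : J → I}

theorem exists_small_area (H : IsCircleDomainInverse Ω c r Ωt ct rt h σ) (hΩt : IsOpen Ωt)
    (hfam : IsSchottkyFamily Ω c r) (hfamt : IsSchottkyFamily Ωt ct rt) {n : ℕ} (hn : 0 < n)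
    {W : Fin n → Set ℂ} (hW : ∀ k, IsOpen (W k)) (hWd : Pairwise fun k l => Disjoint (W k) (W l)) :
    ∃ k, n * volume (h '' (circleDomain Ωt ct rt ∩ W k)) ≤ volume Ω ∧
      ∀ F : Finset J, (∀ j ∈ F, closedBall (ct j) (rt j) ⊆ W k) →
        n * ∑ j ∈ F, volume (ball (c (σ j)) (r (σ j))) ≤ volume Ω := by
  set D : Fin n → Set ℂ := fun k => h '' (circleDomain Ωt ct rt ∩ W k) ∪
    ⋃ j ∈ {j | closedBall (ct j) (rt j) ⊆ W k}, ball (c (σ j)) (r (σ j)) with hD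
  have hcont : ContinuousOn h (circleDomain Ωt ct rt) := H.differentiableOn.continuousOn
  have hbd : Pairwise fun j k => Disjoint (ball (c (σ j)) (r (σ j))) (ball (c (σ k)) (r (σ k))) :=
    fun j k hjk => (hfam.2.2 (H.injective.ne hjk)).mono ball_subset_closedBall
      ball_subset_closedBall
  obtain ⟨k, hk⟩ : ∃ k, n * volume (D k) ≤ volume Ω := by
    refine exists_mul_measure_le hn (fun k => ?_) (fun k => ?_) fun k l hkl => ?_
    · refine MeasurableSet.union ?_ ?_
      · exact ((isOpen_circleDomain hΩt).inter (hW k)).measurableSet.image_of_continuousOn_injOn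
          (hcont.mono inter_subset_left) (H.injOn.mono inter_subset_left)
      · exact (isOpen_biUnion fun j _ => isOpen_ball).measurableSet
    · refine union_subset ?_ (iUnion₂_subset fun j _ => ball_subset_closedBall.trans (hfam.2.1 _))
      rintro _ ⟨w, hw, rfl⟩
      exact H.mapsTo hw.1
    · rw [hD]
      refine disjoint_left.2 ?_
      rintro x (⟨w, hw, rfl⟩ | hx) (⟨w', hw', hww⟩ | hx')
      · exact disjoint_left.1 (hWd hkl) hw.2 (H.injOn hw'.1 hw.1 hww ▸ hw'.2)
      · obtain ⟨j, -, hj⟩ := mem_iUnion₂.1 hx'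
        exact H.notMem w hw.1 j (ball_subset_closedBall hj)
      · obtain ⟨j, -, hj⟩ := mem_iUnion₂.1 hx
        exact H.notMem w' hw'.1 j (hww ▸ ball_subset_closedBall hj)
      · obtain ⟨j, hjk, hj⟩ := mem_iUnion₂.1 hx
        obtain ⟨j', hjl, hj'⟩ := mem_iUnion₂.1 hx'
        by_cases hjj : j = j'
        · subst hjj
          exact disjoint_left.1 (hWd hkl) (hjk (mem_closedBall_self (hfamt.1 j).le))
            (hjl (mem_closedBall_self (hfamt.1 j).le))
        · exact disjoint_left.1 (hbd hjj) hj hj'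
  refine ⟨k, le_trans (by gcongr; exact subset_union_left) hk, fun F hF => le_trans ?_ hk⟩
  rw [← measure_biUnion_finset (fun i _ j _ hij => hbd hij) fun _ _ => measurableSet_ball]
  gcongr
  exact (iUnion₂_subset fun j hj => subset_biUnion_of_mem (u := fun j => ball (c (σ j)) (r (σ j)))
    (hF j hj)).trans subset_union_right

end IsCircleDomainInverse

theorem volume_setOf_abs_exp_sub_le {R D ρ : ℝ} (hR : 0 < R) :
    volume ({t : ℝ | |Real.exp t - D| ≤ ρ} ∩ Ioi (Real.log R)) ≤ ENNReal.ofReal (2 * ρ / R) := by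
  have key : ∀ {t t' : ℝ}, Real.log R < t → t ≤ t' → R * (t' - t) ≤ Real.exp t' - Real.exp t := by
    intro t t' ht htt
    have h1 : R ≤ Real.exp t := ((Real.log_lt_iff_lt_exp hR).1 ht).le
    have h2 : Real.exp t' = Real.exp t * Real.exp (t' - t) := by
      rw [← Real.exp_add]; ring_nf
    have h3 := Real.add_one_le_exp (t' - t)
    rw [h2]
    nlinarith [mul_le_mul_of_nonneg_right h1 (sub_nonneg.2 htt), Real.exp_pos t]
  refine (Real.volume_le_diam _).trans (ediam_le fun t ht t' ht' => ?_)
  rw [edist_dist]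
  refine ENNReal.ofReal_le_ofReal ?_
  rw [le_div_iff₀ hR, Real.dist_eq]
  have h1 : |Real.exp t - D| ≤ ρ := ht.1
  have h2 : |Real.exp t' - D| ≤ ρ := ht'.1
  rw [abs_le] at h1 h2
  rcases le_total t t' with h | h
  · rw [abs_of_nonpos (by linarith)]
    linarith [key ht.2 h]
  · rw [abs_of_nonneg (by linarith)]
    linarith [key ht'.2 h]

theorem IsCircleDomainInverse.exists_short_circle {I J : Type*} [Finite J] {Ω Ωt : Set ℂ}
    {c : I → ℂ} {r : I → ℝ} {ct : J → ℂ} {rt : J → ℝ} {h : ℂ → ℂ} {σ : J → I}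
    (H : IsCircleDomainInverse Ω c r Ωt ct rt h σ) (hΩt : IsOpen Ωt)
    (hfamt : IsSchottkyFamily Ωt ct rt) (hr : ∀ i, 0 < r i) {p : ℂ} {R a E l : ℝ} (hR : 0 < R)
    (ha : 0 < a) (hE : 0 ≤ E)
    (harea : volume (h '' (circleDomain Ωt ct rt ∩
      {w | R / 3 < dist w p ∧ dist w p < 8 * R / 3})) ≤ ENNReal.ofReal E)
    {F : Finset J}
    (hF : ∀ j ∈ F, closedBall (ct j) (rt j) ⊆ {w | R / 3 < dist w p ∧ dist w p < 8 * R / 3})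
    (hFE : ∑ j ∈ F, r (σ j) ^ 2 ≤ E)
    (hl : a * (2 * Real.pi * Real.log 2) + 3 * E / a + 16 * a < l * Real.log 2) :
    ∃ t ∈ Ioo (Real.log R) (Real.log R + Real.log 2), ∃ m : ℝ, 0 ≤ m ∧
      circleImageLength h p (circleDomain Ωt ct rt) t ≤ ENNReal.ofReal m ∧
      ∀ F' ⊆ F, (∀ j ∈ F', |Real.exp t - dist (ct j) p| ≤ rt j) →
        m + ∑ j ∈ F', 2 * r (σ j) < l := by
  set At := circleDomain Ωt ct rt with hAt
  set B : Set ℝ := Ioo (Real.log R) (Real.log R + Real.log 2) with hB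
  set s : J → Set ℝ := fun j => {t : ℝ | |Real.exp t - dist (ct j) p| ≤ rt j} with hs
  have hsm : ∀ j, MeasurableSet (s j) := fun j =>
    (isClosed_le (by fun_prop) continuous_const).measurableSet
  set f : ℝ → ℝ≥0∞ := fun t => ∑ j ∈ F, (s j).indicator (fun _ => ENNReal.ofReal (2 * r (σ j))) t
    with hf
  have hfm : Measurable f := Finset.measurable_fun_sum _ fun j _ =>
    measurable_const.indicator (hsm j)
  have hlog : 0 < Real.log 2 := Real.log_pos one_lt_two
  have hsum : ∑ j ∈ F, (rt j) ^ 2 ≤ (8 * R / 3) ^ 2 :=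
    sum_sq_radius_le (x := p) F (fun j _ => (hfamt.1 j).le) (by positivity)
      (fun j hj w hw => (hF j hj (ball_subset_closedBall hw)).2)
      fun i _ j _ hij => (hfamt.2.2 hij).mono ball_subset_closedBall ball_subset_closedBall
  have hint : ∫⁻ t in B, f t ≤ ENNReal.ofReal (2 * E / a + 16 * a) := by
    rw [lintegral_finsetSum _ fun j _ => measurable_const.indicator (hsm j)]
    calc ∑ j ∈ F, ∫⁻ t in B, (s j).indicator (fun _ => ENNReal.ofReal (2 * r (σ j))) t
        ≤ ∑ j ∈ F, ENNReal.ofReal (2 * r (σ j) * (2 * rt j / R)) := by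
          refine Finset.sum_le_sum fun j _ => ?_
          rw [setLIntegral_indicator (hsm j), setLIntegral_const,
            ENNReal.ofReal_mul (p := 2 * r (σ j)) (by linarith [hr (σ j)])]
          gcongr
          exact (measure_mono (inter_subset_inter_right _ fun t ht => ht.1)).trans
            (volume_setOf_abs_exp_sub_le (D := dist (ct j) p) hR)
      _ ≤ _ := by
          rw [← ENNReal.ofReal_sum_of_nonneg fun j _ => by
            have := hr (σ j); have := hfamt.1 j; positivity]
          refine ENNReal.ofReal_le_ofReal ?_
          calc ∑ j ∈ F, 2 * r (σ j) * (2 * rt j / R)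
              ≤ ∑ j ∈ F, (2 / a * r (σ j) ^ 2 + 2 * a / R ^ 2 * rt j ^ 2) := by
                refine Finset.sum_le_sum fun j _ => ?_
                have h1 : 2 / a * r (σ j) ^ 2 + 2 * a / R ^ 2 * rt j ^ 2 -
                    2 * r (σ j) * (2 * rt j / R) = 2 / a * (r (σ j) - a * rt j / R) ^ 2 := by
                  field_simp
                  ring
                have h2 : 0 ≤ 2 / a * (r (σ j) - a * rt j / R) ^ 2 := by positivity
                linarith
            _ = 2 / a * ∑ j ∈ F, r (σ j) ^ 2 + 2 * a / R ^ 2 * ∑ j ∈ F, rt j ^ 2 := by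
                rw [Finset.sum_add_distrib, Finset.mul_sum, Finset.mul_sum]
            _ ≤ 2 / a * E + 2 * a / R ^ 2 * (8 * R / 3) ^ 2 := by gcongr
            _ ≤ 2 * E / a + 16 * a := by
                have : 2 * a / R ^ 2 * (8 * R / 3) ^ 2 = 128 / 9 * a := by
                  field_simp
                  ring
                rw [this, div_mul_eq_mul_div]
                linarith
  have hexp : Real.exp (Real.log R + Real.log 2) = R * 2 := by
    rw [Real.exp_add, Real.exp_log hR, Real.exp_log two_pos]
  have hlen := lintegral_circleImageLength_le (p := p) (isOpen_circleDomain (c := ct) (r := rt) hΩt)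
    H.differentiableOn H.injOn (Real.log R) (Real.log R + Real.log 2) ha
  obtain ⟨t, ht, htl⟩ : ∃ t ∈ B, circleImageLength h p At t + f t < ENNReal.ofReal l := by
    by_contra! hcon
    have h1 : ENNReal.ofReal l * volume B ≤ ∫⁻ t in B, (circleImageLength h p At t + f t) := by
      rw [← setLIntegral_const]
      exact setLIntegral_mono' measurableSet_Ioo hcon
    rw [lintegral_add_right _ hfm, hB, Real.volume_Ioo] at h1
    have h2 : ENNReal.ofReal a⁻¹ * volume (h '' (At ∩ {w | Real.exp (Real.log R) < dist w p ∧
        dist w p < Real.exp (Real.log R + Real.log 2)})) ≤ ENNReal.ofReal (a⁻¹ * E) := by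
      rw [ENNReal.ofReal_mul (by positivity)]
      gcongr
      refine (measure_mono ?_).trans harea
      refine image_mono (inter_subset_inter_right _ fun w hw => ?_)
      rw [mem_ofPred_eq, Real.exp_log hR, hexp] at hw
      exact ⟨by linarith [hw.1], by linarith [hw.2]⟩
    have h3 : ENNReal.ofReal l * ENNReal.ofReal (Real.log R + Real.log 2 - Real.log R) ≤
        ENNReal.ofReal (a * (2 * Real.pi * Real.log 2) + 3 * E / a + 16 * a) := by
      refine h1.trans ((add_le_add (hlen.trans (add_le_add_right h2 _)) hint).trans_eq ?_)
      rw [add_sub_cancel_left, ← ENNReal.ofReal_add (by positivity) (by positivity),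
        ← ENNReal.ofReal_add (by positivity) (by positivity)]
      congr 1
      field_simp
      ring
    rw [add_sub_cancel_left, ← ENNReal.ofReal_mul' hlog.le] at h3
    exact h3.not_gt ((ENNReal.ofReal_lt_ofReal_iff_of_nonneg (by positivity)).2 hl)
  have hfin : circleImageLength h p At t ≠ ∞ :=
    ((le_self_add.trans_lt htl).trans ENNReal.ofReal_lt_top).ne
  refine ⟨t, ht, (circleImageLength h p At t).toReal, ENNReal.toReal_nonneg,
    (ENNReal.ofReal_toReal hfin).ge, fun F' hF' hhit => ?_⟩
  have hnn : 0 ≤ ∑ j ∈ F', 2 * r (σ j) := Finset.sum_nonneg fun j _ => by linarith [hr (σ j)]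
  refine (ENNReal.ofReal_lt_ofReal_iff_of_nonneg (by positivity)).1 (lt_of_le_of_lt ?_ htl)
  rw [ENNReal.ofReal_add ENNReal.toReal_nonneg hnn, ENNReal.ofReal_toReal hfin,
    ENNReal.ofReal_sum_of_nonneg fun j _ => by linarith [hr (σ j)]]
  gcongr
  refine le_trans (Finset.sum_le_sum fun j hj => ?_) (Finset.sum_le_sum_of_subset hF')
  have : t ∈ s j := hhit j hj
  rw [indicator_of_mem this]

theorem exists_ball_subset_of_mem_closedBall {c w p : ℂ} {r ρ e : ℝ} (hw : w ∈ closedBall c r)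
    (hwp : dist w p ≤ ρ) (he : 0 < e) (her : e ≤ r) :
    ∃ x, ball x e ⊆ ball c r ∧ ball x e ⊆ ball p (ρ + 2 * e) := by
  have hr : 0 < r := he.trans_le her
  have hs : e / r ≤ 1 := (div_le_one hr).2 her
  have hs0 : 0 ≤ e / r := by positivity
  have hw' : dist w c ≤ r := hw
  refine ⟨AffineMap.lineMap w c (e / r), ball_subset_ball' ?_, ball_subset_ball' ?_⟩
  · rw [dist_lineMap_right, Real.norm_of_nonneg (by linarith)]
    have : (1 - e / r) * r = r - e := by field_simp
    nlinarith [mul_le_mul_of_nonneg_left hw' (sub_nonneg.2 hs)]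
  · have h1 : dist (AffineMap.lineMap w c (e / r)) w ≤ e := by
      rw [dist_lineMap_left, Real.norm_of_nonneg hs0]
      calc e / r * dist w c ≤ e / r * r := by gcongr
        _ = e := by field_simp
    linarith [dist_triangle (AffineMap.lineMap w c (e / r)) w p]

theorem IsCircleDomainInverse.exists_good_circle {I : Type*} {Ω : Set ℂ} {c : I → ℂ} {r : I → ℝ}
    (hΩv : volume Ω ≠ ∞) (hfam : IsSchottkyFamily Ω c r) {δ l : ℝ} (hδ : 0 < δ) (hl : 0 < l) :
    ∃ η, 0 < η ∧ η < δ ∧ ∀ {n : ℕ} {Ωt : Set ℂ} {ct : Fin n → ℂ} {rt : Fin n → ℝ} {h : ℂ → ℂ}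
      {σ : Fin n → I}, IsCircleDomainInverse Ω c r Ωt ct rt h σ → IsOpen Ωt →
      IsSchottkyFamily Ωt ct rt → ∀ p : ℂ, ∃ ρ ∈ Ioo η δ, ∃ m : ℝ, 0 ≤ m ∧
        (∀ u : StrongDual ℝ ℂ, ‖u‖ ≤ 1 →
          volume (u '' (h '' (circleDomain Ωt ct rt ∩ sphere p ρ))) ≤ ENNReal.ofReal m) ∧
        ∃ F L : Finset (Fin n), L.card ≤ 64 ∧ m + ∑ j ∈ F, 2 * r (σ j) < l ∧
          ∀ j, ∀ w ∈ closedBall (ct j) (rt j), dist w p = ρ → j ∈ F ∨ j ∈ L := by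
  classical
  set V := (volume Ω).toReal with hV
  have hV0 : 0 ≤ V := ENNReal.toReal_nonneg
  have hΩV : volume Ω = ENNReal.ofReal V := (ENNReal.ofReal_toReal hΩv).symm
  obtain ⟨N, hN⟩ := exists_nat_gt (1000 * V / l ^ 2)
  have hN0 : 0 < N := Nat.cast_pos.1 (lt_of_le_of_lt (by positivity) hN)
  have hN0' : (0 : ℝ) < N := Nat.cast_pos.2 hN0
  refine ⟨δ / 16 ^ (N + 1), by positivity, div_lt_self hδ (one_lt_pow₀ (by norm_num) (by simp)), ?_⟩
  intro n Ωt ct rt h σ H hΩt hfamt p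
  set R : Fin N → ℝ := fun k => δ / 16 ^ (k.1 + 1) with hR
  have hR0 : ∀ k, 0 < R k := fun k => by positivity
  have hlt : ∀ k l : Fin N, k < l → 16 * R l ≤ R k := by
    intro k l hkl
    have h1 : (16 : ℝ) ^ (k.1 + 1) * 16 ≤ 16 ^ (l.1 + 1) := by
      rw [← pow_succ]
      exact pow_le_pow_right₀ (by norm_num) (by have : k.1 < l.1 := hkl; omega)
    simp only [hR]
    rw [mul_div_assoc', div_le_div_iff₀ (by positivity) (by positivity)]
    nlinarith
  set W : Fin N → Set ℂ := fun k => {w | R k / 3 < dist w p ∧ dist w p < 8 * R k / 3} with hW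
  have hWo : ∀ k, IsOpen (W k) := fun k =>
    (isOpen_lt (f := fun _ => R k / 3) (g := fun w => dist w p) (by fun_prop) (by fun_prop)).inter
      (isOpen_lt (f := fun w => dist w p) (g := fun _ => 8 * R k / 3) (by fun_prop) (by fun_prop))
  have hWd : Pairwise fun k l => Disjoint (W k) (W l) := by
    intro k l hkl
    refine disjoint_left.2 fun w hw hw' => ?_
    have h1 : R k / 3 < dist w p ∧ dist w p < 8 * R k / 3 := hw
    have h2 : R l / 3 < dist w p ∧ dist w p < 8 * R l / 3 := hw'
    rcases lt_or_gt_of_ne hkl with h' | h'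
    · linarith [hlt _ _ h', hR0 k, hR0 l]
    · linarith [hlt _ _ h', hR0 k, hR0 l]
  obtain ⟨k, hk1, hk2⟩ := H.exists_small_area hΩt hfam hfamt hN0 hWo hWd
  have hNE : volume Ω = N * ENNReal.ofReal (V / N) := by
    rw [hΩV, ← ENNReal.ofReal_natCast, ← ENNReal.ofReal_mul hN0'.le, mul_div_cancel₀ _ hN0'.ne']
  have hNne : (N : ℝ≥0∞) ≠ 0 := by simpa using hN0.ne'
  rw [hNE, ENNReal.mul_le_mul_iff_right hNne (by simp)] at hk1
  set F := Finset.univ.filter fun j => rt j < R k / 3 ∧ closedBall (ct j) (rt j) ⊆ W k with hF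
  have hFE : ∑ j ∈ F, r (σ j) ^ 2 ≤ V / N := by
    have h1 := hk2 F fun j hj => (Finset.mem_filter.1 hj).2.2
    rw [hNE, ENNReal.mul_le_mul_iff_right hNne (by simp)] at h1
    refine (ENNReal.ofReal_le_ofReal_iff (by positivity)).1 (le_trans ?_ h1)
    rw [ENNReal.ofReal_sum_of_nonneg fun _ _ => sq_nonneg _]
    refine Finset.sum_le_sum fun j _ => ?_
    rw [Complex.volume_ball, ENNReal.ofReal_pow (hfam.1 _).le]
    refine le_mul_of_one_le_right' ?_
    rw [ENNReal.one_le_coe_iff]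
    rw [← NNReal.coe_le_coe, NNReal.coe_real_pi, NNReal.coe_one]
    linarith [Real.pi_gt_three]
  have hsmall : l / 100 * (2 * Real.pi * Real.log 2) + 3 * (V / N) / (l / 100) + 16 * (l / 100) <
      l * Real.log 2 := by
    have h1 : V / N < l ^ 2 / 1000 := by
      rw [div_lt_iff₀ hN0']
      rw [div_lt_iff₀ (by positivity)] at hN
      linarith
    have h2 : 3 * (V / N) / (l / 100) < 3 / 10 * l := by
      rw [div_lt_iff₀ (by positivity)]
      nlinarith
    have h3 := Real.log_two_gt_d9
    have h4 := Real.log_two_lt_d9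
    have h5 : Real.pi * Real.log 2 < 3.15 * 0.7 :=
      mul_lt_mul'' Real.pi_lt_d2 (by linarith) Real.pi_pos.le (by linarith)
    nlinarith
  obtain ⟨t, ht, m, hm, hlen, hsum⟩ := H.exists_short_circle hΩt hfamt hfam.1 (hR0 k)
    (by positivity : 0 < l / 100) (by positivity : 0 ≤ V / N) hk1
    (fun j hj => (Finset.mem_filter.1 hj).2.2) hFE hsmall
  have ht1 : R k < Real.exp t := (Real.log_lt_iff_lt_exp (hR0 k)).1 ht.1
  have ht2 : Real.exp t < 2 * R k := by
    have := Real.exp_lt_exp.2 ht.2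
    rwa [Real.exp_add, Real.exp_log (hR0 k), Real.exp_log two_pos, mul_comm] at this
  have hhit : ∀ j, ∀ w ∈ closedBall (ct j) (rt j), dist w p = Real.exp t →
      |Real.exp t - dist (ct j) p| ≤ rt j := fun j w hw hwt => by
    rw [← hwt]
    exact (abs_dist_sub_le w (ct j) p).trans hw
  refine ⟨Real.exp t, ⟨lt_of_le_of_lt ?_ ht1, ht2.trans_le ?_⟩, m, hm, fun u hu =>
    (volume_image_circle_le (isOpen_circleDomain hΩt) H.differentiableOn t hu).trans hlen,
    F.filter fun j => |Real.exp t - dist (ct j) p| ≤ rt j,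
    Finset.univ.filter fun j => R k / 3 ≤ rt j ∧ ∃ w ∈ closedBall (ct j) (rt j),
      dist w p = Real.exp t, ?_,
    hsum _ (Finset.filter_subset _ _) fun j hj => (Finset.mem_filter.1 hj).2, ?_⟩
  · simp only [hR]
    gcongr
    · norm_num
    · exact k.2.le
  · simp only [hR]
    rw [mul_div_assoc', div_le_iff₀ (by positivity), pow_succ]
    nlinarith [one_le_pow₀ (by norm_num : (1 : ℝ) ≤ 16) (n := k.1)]
  · set L := Finset.univ.filter fun j => R k / 3 ≤ rt j ∧ ∃ w ∈ closedBall (ct j) (rt j),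
      dist w p = Real.exp t with hL
    have hex : ∀ j, ∃ x, j ∈ L → ball x (R k / 3) ⊆ ball (ct j) (rt j) ∧
        ball x (R k / 3) ⊆ ball p (2 * R k + 2 * (R k / 3)) := by
      intro j
      by_cases hj : j ∈ L
      · obtain ⟨-, hj1, w, hw, hwt⟩ := Finset.mem_filter.1 hj
        obtain ⟨x, hx⟩ := exists_ball_subset_of_mem_closedBall hw (hwt.le.trans ht2.le)
          (by linarith [hR0 k]) hj1
        exact ⟨x, fun _ => hx⟩
      · exact ⟨0, fun h' => absurd h' hj⟩
    choose x hx using hex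
    have h1 := sum_sq_radius_le L (c := x) (r := fun _ => R k / 3)
      (x := p) (ρ := 2 * R k + 2 * (R k / 3)) (fun j _ => by linarith [hR0 k]) (by linarith [hR0 k])
      (fun j hj => (hx j hj).2) fun i hi j hj hij => (hfamt.2.2 hij).mono
        ((hx i hi).1.trans ball_subset_closedBall) ((hx j hj).1.trans ball_subset_closedBall)
    rw [Finset.sum_const, nsmul_eq_mul] at h1
    have h2 : (L.card : ℝ) ≤ 64 := by
      have h3 : (2 * R k + 2 * (R k / 3)) ^ 2 = 64 * (R k / 3) ^ 2 := by ring
      rw [h3] at h1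
      exact le_of_mul_le_mul_right h1 (by have := hR0 k; positivity)
    exact_mod_cast h2
  · intro j w hw hwt
    by_cases hj : R k / 3 ≤ rt j
    · exact Or.inr (Finset.mem_filter.2 ⟨Finset.mem_univ _, hj, w, hw, hwt⟩)
    · push Not at hj
      refine Or.inl (Finset.mem_filter.2 ⟨Finset.mem_filter.2 ⟨Finset.mem_univ _, hj, ?_⟩,
        hhit j w hw hwt⟩)
      intro x hx
      have h1 : dist x (ct j) ≤ rt j := hx
      have h2 : dist w (ct j) ≤ rt j := hw
      have h3 := abs_le.1 (abs_dist_sub_le x w p)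
      have h4 := dist_triangle_right x w (ct j)
      exact ⟨by linarith, by linarith⟩

theorem exists_mem_frontier_of_exit {X : Type*} [TopologicalSpace X] {U : Set X} (hU : IsOpen U)
    {κ : ℝ → X} (hκ : Continuous κ) {a : ℝ} (ha : κ a ∈ closure U) (hex : ∃ θ ≥ a, κ θ ∉ U) :
    ∃ b ≥ a, κ b ∈ frontier U ∧ ∀ θ ∈ Ico a b, κ θ ∈ U := by
  set A : Set ℝ := Ici a ∩ κ ⁻¹' Uᶜ with hA
  have hAc : IsClosed A := isClosed_Ici.inter (hU.isClosed_compl.preimage hκ)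
  have hAb : BddBelow A := ⟨a, fun θ hθ => hθ.1⟩
  have hmem : sInf A ∈ A := hAc.csInf_mem hex hAb
  have hlt : ∀ θ ∈ Ico a (sInf A), κ θ ∈ U := fun θ hθ => by
    by_contra hcon
    exact hθ.2.not_ge (csInf_le hAb ⟨hθ.1, hcon⟩)
  refine ⟨sInf A, hmem.1, ?_, hlt⟩
  rw [hU.frontier_eq]
  refine ⟨?_, hmem.2⟩
  rcases eq_or_lt_of_le (show a ≤ sInf A from hmem.1) with h | h
  · rwa [← h]
  · refine closure_mono (image_subset_iff.2 hlt)
      (image_closure_subset_closure_image hκ ⟨sInf A, ?_, rfl⟩)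
    rw [closure_Ico h.ne]
    exact right_mem_Icc.2 h.le

theorem exists_last_mem {X : Type*} [TopologicalSpace X] {Y : Set X} (hY : IsClosed Y)
    {κ : ℝ → X} (hκ : Continuous κ) {a b : ℝ} (hab : a ≤ b) (ha : κ a ∈ Y) :
    ∃ θ ∈ Icc a b, κ θ ∈ Y ∧ ∀ φ ∈ Ioc θ b, κ φ ∉ Y := by
  set A : Set ℝ := Icc a b ∩ κ ⁻¹' Y with hA
  have hAc : IsClosed A := isClosed_Icc.inter (hY.preimage hκ)
  have hAb : BddAbove A := ⟨b, fun θ hθ => hθ.1.2⟩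
  have hmem : sSup A ∈ A := hAc.csSup_mem ⟨a, left_mem_Icc.2 hab, ha⟩ hAb
  exact ⟨sSup A, hmem.1, hmem.2, fun φ hφ hφY =>
    hφ.1.not_ge (le_csSup hAb ⟨⟨hmem.1.1.trans hφ.1.le, hφ.2⟩, hφY⟩)⟩

theorem exists_circleMap_eq_ge {p w : ℂ} {ρ : ℝ} (hw : dist w p = ρ) (a : ℝ) :
    ∃ θ ≥ a, circleMap p ρ θ = w := by
  have h1 : w ∈ range (circleMap p ρ) := by
    rw [range_circleMap, abs_of_nonneg (hw ▸ dist_nonneg)]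
    exact hw
  obtain ⟨θ, rfl⟩ := h1
  obtain ⟨φ, hφ, hφe⟩ := (periodic_circleMap p ρ).exists_mem_Ico Real.two_pi_pos θ a
  exact ⟨φ, hφ.1, hφe.symm⟩

theorem IsCircleDomainInverse.exists_uniform_circle {I : Type*} {Ω : Set ℂ} {c : I → ℂ} {r : I → ℝ}
    (hΩ : IsOpen Ω) (hb : Bornology.IsBounded Ω) (hne : (frontier Ω).Nonempty)
    (hfam : IsSchottkyFamily Ω c r) {δ s : ℝ} (hδ : 0 < δ) (hs : 0 < s) :
    ∃ η, 0 < η ∧ η < δ ∧ ∀ {n : ℕ} {Ωt : Set ℂ} {ct : Fin n → ℂ} {rt : Fin n → ℝ} {h : ℂ → ℂ}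
      {σ : Fin n → I}, IsCircleDomainInverse Ω c r Ωt ct rt h σ → IsOpen Ωt →
      IsSchottkyFamily Ωt ct rt → IsPreconnected (frontier Ωt) → ∀ p ∈ frontier Ωt,
      (∃ q ∈ frontier Ωt, δ ≤ dist q p) → ∃ ρ ∈ Ioo η δ,
        (∀ w ∈ closure (circleDomain Ωt ct rt), dist w p = ρ →
          ∃ z ∈ frontier Ωt, dist z p = ρ ∧ dist (h w) (h z) < s) ∧
        ∀ j, ∀ w ∈ closedBall (ct j) (rt j), dist w p = ρ → 2 * r (σ j) < s := by
  classical
  obtain ⟨l, hl, hgap⟩ := exists_gap_of_finset r (fun i => infDist (c i) (frontier Ω) - r i)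
    (fun τ hτ => hfam.exists_le_infDist_sub_radius hΩ hb hne hτ) 64 s hs
  obtain ⟨η, hη, hηδ, hgood⟩ := exists_good_circle hb.measure_lt_top.ne hfam hδ hl
  refine ⟨η, hη, hηδ, ?_⟩
  intro n Ωt ct rt h σ H hΩt hfamt hconn p hp ⟨q, hq, hqp⟩
  obtain ⟨ρ, hρ, m, hm, hlen, F, L, hL, hF, hhit⟩ := hgood H hΩt hfamt p
  obtain ⟨G, T, hLGT, hTs, hTG⟩ := hgap (L.image σ) (Finset.card_image_le.trans hL)
  have hρ0 : 0 < ρ := hη.trans hρ.1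
  have hr2 : ∀ i, 0 ≤ 2 * r i := fun i => by linarith [hfam.1 i]
  have hT0 : 0 ≤ ∑ i ∈ T, 2 * r i := Finset.sum_nonneg fun i _ => hr2 i
  have hF0 : 0 ≤ ∑ j ∈ F, 2 * r (σ j) := Finset.sum_nonneg fun i _ => hr2 _
  obtain ⟨z, hz, hzρ⟩ : ∃ z ∈ frontier Ωt, dist z p = ρ :=
    hconn.intermediate_value hp hq (f := fun z => dist z p) (by fun_prop)
      ⟨by simpa using hρ0.le, hρ.2.le.trans hqp⟩
  set κ : ℝ → ℂ := circleMap p ρ with hκ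
  have hκc : Continuous κ := continuous_circleMap p ρ
  have hκρ : ∀ θ, dist (κ θ) p = ρ := fun θ => circleMap_mem_sphere p hρ0.le θ
  have hexit : ∀ a, ∃ θ ≥ a, κ θ ∉ Ωt := fun a => by
    obtain ⟨θ, hθ, hθz⟩ := exists_circleMap_eq_ge hzρ a
    refine ⟨θ, hθ, ?_⟩
    rw [hκ, hθz]
    rw [hΩt.frontier_eq] at hz
    exact hz.2
  have hfrcl := frontier_subset_closure_circleDomain hΩt fun j => hfamt.2.1 j
  have harc : ∀ {a b : ℝ}, a ≤ b → κ a ∈ closure (circleDomain Ωt ct rt) → κ b ∈ frontier Ωt →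
      (∀ θ ∈ Ioo a b, κ θ ∈ Ωt) →
      (∀ θ ∈ Ioc a b, ∀ j, κ θ ∈ closedBall (ct j) (rt j) → σ j ∉ G) →
      dist (h (κ a)) (h (κ b)) < l + ∑ i ∈ T, 2 * r i := by
    intro a b hab ha hb' hmid hG
    have h1 := H.dist_le_of_arc hΩt hfamt hfam.1 hκc (Z := sphere p ρ) hκρ hab ha (hfrcl hb') hmid
      (T := F.image σ ∪ T) (fun θ hθ j hj => by
        rcases hhit j _ hj (hκρ θ) with h' | h'
        · exact Finset.mem_union_left _ (Finset.mem_image_of_mem _ h')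
        · exact Finset.mem_union_right _
            ((hLGT _ (Finset.mem_image_of_mem _ h')).resolve_left (hG θ hθ j hj))) hm hlen
    have h2 : ∑ i ∈ F.image σ ∪ T, 2 * r i ≤ ∑ j ∈ F, 2 * r (σ j) + ∑ i ∈ T, 2 * r i := by
      rw [← Finset.sum_image (f := fun i => 2 * r i) H.injective.injOn,
        ← Finset.sum_union_inter]
      exact le_add_of_nonneg_right (Finset.sum_nonneg fun i _ => hr2 i)
    linarith
  have hclaim : ∀ j, ∀ w ∈ closedBall (ct j) (rt j), dist w p = ρ → σ j ∉ G := by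
    intro j w hw hwρ hjG
    obtain ⟨a, -, rfl⟩ := exists_circleMap_eq_ge hwρ 0
    obtain ⟨b, hab, hbf, hint⟩ := exists_mem_frontier_of_exit hΩt hκc
      (subset_closure (hfamt.2.1 j hw)) (hexit a)
    set Y : Set ℂ := ⋃ j ∈ {j | σ j ∈ G}, closedBall (ct j) (rt j) with hY
    have hYc : IsClosed Y := (toFinite _).isClosed_biUnion fun j _ => isClosed_closedBall
    obtain ⟨θ, hθ, hθY, hlast⟩ := exists_last_mem hYc hκc hab
      (mem_biUnion (show σ j ∈ G from hjG) hw)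
    obtain ⟨k, hk, hθk⟩ := mem_iUnion₂.1 hθY
    have hbΩ : κ b ∉ Ωt := by
      rw [hΩt.frontier_eq] at hbf
      exact hbf.2
    have hθb : θ < b := lt_of_le_of_ne hθ.2 fun h' => hbΩ (h' ▸ hfamt.2.1 k hθk)
    have hsph : κ θ ∈ sphere (ct k) (rt k) := by
      refine le_antisymm hθk (not_lt.1 fun hlt => ?_)
      have h1 : ∀ᶠ φ in 𝓝[>] θ, κ φ ∈ ball (ct k) (rt k) :=
        (hκc.continuousAt.eventually_mem (isOpen_ball.mem_nhds hlt)).filter_mono nhdsWithin_le_nhds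
      obtain ⟨φ, hφ1, hφ2⟩ := (h1.and (Ioc_mem_nhdsGT hθb)).exists
      exact hlast φ hφ2 (mem_biUnion hk (ball_subset_closedBall hφ1))
    have h1 := harc hθb.le (sphere_subset_closure_circleDomain hΩt hfamt k hsph) hbf
      (fun φ hφ => hint φ ⟨hθ.1.trans hφ.1.le, hφ.2⟩)
      fun φ hφ i hi hiG => hlast φ hφ (mem_biUnion (show σ i ∈ G from hiG) hi)
    have h2 := infDist_sub_radius_le_dist (H.mapsTo_sphere k hsph) (H.mapsTo_frontier hbf)
    linarith [hTG _ hk]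
  refine ⟨ρ, hρ, fun w hw hwρ => ?_, fun j w hw hwρ => ?_⟩
  · obtain ⟨a, -, rfl⟩ := exists_circleMap_eq_ge hwρ 0
    obtain ⟨b, hab, hbf, hint⟩ := exists_mem_frontier_of_exit hΩt hκc
      (closure_mono circleDomain_subset hw) (hexit a)
    refine ⟨κ b, hbf, hκρ b, ?_⟩
    have h1 := harc hab hw hbf (fun θ hθ => hint θ ⟨hθ.1.le, hθ.2⟩)
      fun θ _ j hj => hclaim j _ hj (hκρ θ)
    linarith
  · rcases hhit j w hw hwρ with hj | hj
    · have := Finset.single_le_sum (f := fun j => 2 * r (σ j)) (fun i _ => hr2 _) hj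
      linarith
    · have := Finset.single_le_sum (f := fun i => 2 * r i) (fun i _ => hr2 _)
        ((hLGT _ (Finset.mem_image_of_mem _ hj)).resolve_left (hclaim j w hw hwρ))
      linarith

theorem exists_isCompact_isPreconnected_superset {Ω K : Set ℂ} (hΩ : IsOpen Ω) (hc : IsConnected Ω)
    (hK : IsCompact K) (hKΩ : K ⊆ Ω) {x : ℂ} (hx : x ∈ Ω) :
    ∃ Q, IsCompact Q ∧ IsPreconnected Q ∧ x ∈ Q ∧ K ⊆ Q ∧ Q ⊆ Ω := by
  have hpath : IsPathConnected Ω := hΩ.isConnected_iff_isPathConnected.1 hc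
  have hrad : ∀ y, ∃ e > 0, y ∈ Ω → closedBall y e ⊆ Ω := fun y => by
    by_cases hy : y ∈ Ω
    · obtain ⟨e, he, hsub⟩ := nhds_basis_closedBall.mem_iff.1 (hΩ.mem_nhds hy)
      exact ⟨e, he, fun _ => hsub⟩
    · exact ⟨1, one_pos, fun h => absurd h hy⟩
  choose e he hsub using hrad
  have hex : ∀ y ∈ Ω, ∃ X, IsCompact X ∧ IsPreconnected X ∧ x ∈ X ∧ X ⊆ Ω ∧
      closedBall y (e y) ⊆ X := by
    intro y hy
    obtain ⟨γ, hγ⟩ := hpath.joinedIn x hx y hy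
    refine ⟨range γ ∪ closedBall y (e y), (isCompact_range γ.continuous).union
      (isCompact_closedBall _ _), ?_, Or.inl ⟨0, γ.source⟩,
      union_subset (range_subset_iff.2 hγ) (hsub y hy), subset_union_right⟩
    exact (isPreconnected_range γ.continuous).union y ⟨1, γ.target⟩
      (mem_closedBall_self (he y).le) (convex_closedBall y (e y)).isPreconnected
  choose! X hXc hXp hxX hXΩ hX using hex
  obtain ⟨t, ht, htK⟩ := hK.elim_nhds_subcover (fun y => closedBall y (e y))
    fun y _ => closedBall_mem_nhds y (he y)
  have htΩ : ∀ y ∈ t, y ∈ Ω := fun y hy => hKΩ (ht y hy)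
  refine ⟨{x} ∪ ⋃ y ∈ t, X y, isCompact_singleton.union (t.isCompact_biUnion fun y hy =>
    hXc y (htΩ y hy)), ?_, Or.inl rfl, htK.trans ?_, union_subset (singleton_subset_iff.2 hx)
    (iUnion₂_subset fun y hy => hXΩ y (htΩ y hy))⟩
  · have heq : {x} ∪ ⋃ y ∈ t, X y = ⋃₀ ({{x}} ∪ X '' t) := by
      rw [sUnion_union, sUnion_singleton, sUnion_image]
      rfl
    rw [heq]
    refine isPreconnected_sUnion x _ ?_ ?_
    · rintro s (rfl | ⟨y, hy, rfl⟩)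
      · rfl
      · exact hxX y (htΩ y hy)
    · rintro s (rfl | ⟨y, hy, rfl⟩)
      · exact isPreconnected_singleton
      · exact hXp y (htΩ y hy)
  · exact (iUnion₂_mono fun y hy => hX y (htΩ y hy)).trans subset_union_right

theorem isCompact_setOf_le_infDist_frontier {Ω : Set ℂ} (hΩ : IsOpen Ω)
    (hb : Bornology.IsBounded Ω) {ε : ℝ} (hε : 0 < ε) :
    IsCompact {y ∈ Ω | ε ≤ infDist y (frontier Ω)} := by
  have h1 : {y ∈ Ω | ε ≤ infDist y (frontier Ω)} =
      closure Ω ∩ {y | ε ≤ infDist y (frontier Ω)} := by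
    ext y
    refine ⟨fun h => ⟨subset_closure h.1, h.2⟩, fun h => ⟨?_, h.2⟩⟩
    by_contra hy
    have h2 : y ∈ frontier Ω := by
      rw [hΩ.frontier_eq]
      exact ⟨h.1, hy⟩
    have h3 : ε ≤ infDist y (frontier Ω) := h.2
    rw [infDist_zero_of_mem h2] at h3
    exact h3.not_gt hε
  rw [h1]
  exact hb.isCompact_closure.inter_right (isClosed_le continuous_const (continuous_infDist_pt _))

theorem exists_preconnected_away {Ω Z : Set ℂ} (hΩ : IsOpen Ω) (hc : IsConnected Ω)
    (hb : Bornology.IsBounded Ω) (hZ : IsClosed Z) (hZf : Z ⊆ frontier Ω)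
    (hne : (frontier Ω \ Z).Nonempty) {ε : ℝ} (hε : 0 < ε) :
    ∃ s > 0, ∃ b ∈ frontier Ω \ Z, ∃ P ⊆ closure Ω, IsPreconnected P ∧ b ∈ P ∧
      {y ∈ Ω | ε ≤ infDist y (frontier Ω)} ⊆ P ∧ ∀ x ∈ P, ∀ z ∈ Z, s ≤ dist x z := by
  obtain ⟨b₀, hb₀, hb₀Z⟩ := hne
  obtain ⟨d, hd, hdZ⟩ := Metric.mem_nhds_iff.1 (hZ.isOpen_compl.mem_nhds hb₀Z)
  obtain ⟨x, hx, hxb⟩ := Metric.mem_closure_iff.1 (frontier_subset_closure hb₀) (d / 2)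
    (by positivity)
  rw [hΩ.frontier_eq] at hb₀
  obtain ⟨b, hbΩ, hbx⟩ := hΩ.isClosed_compl.exists_infDist_eq_dist ⟨b₀, hb₀.2⟩ x
  have hball : ball x (dist x b) ⊆ Ω := by
    rw [← hbx]
    exact ball_infDist_compl_subset
  have hxb0 : dist x b ≤ dist x b₀ := hbx ▸ infDist_le_dist_of_mem hb₀.2
  have hxb' : x ≠ b := fun h => hbΩ (h ▸ hx)
  have hbcl : b ∈ closure Ω := by
    refine closure_mono hball ?_
    rw [closure_ball x (dist_ne_zero.2 hxb'), mem_closedBall, dist_comm]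
  have hbf : b ∈ frontier Ω := by
    rw [hΩ.frontier_eq]
    exact ⟨hbcl, hbΩ⟩
  have hbZ : b ∉ Z := by
    refine fun h => hdZ ?_ h
    rw [mem_ball]
    linarith [dist_triangle_left b b₀ x, dist_comm x b₀]
  obtain ⟨Q, hQ, hQp, hxQ, hKQ, hQΩ⟩ := exists_isCompact_isPreconnected_superset hΩ hc
    (isCompact_setOf_le_infDist_frontier hΩ hb hε) (fun y hy => hy.1) hx
  have hseg : segment ℝ x b ⊆ Ω ∪ {b} := by
    rw [segment_eq_image_lineMap]
    rintro _ ⟨t, ht, rfl⟩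
    rcases eq_or_lt_of_le ht.2 with rfl | h
    · right
      simp
    · refine Or.inl (hball ?_)
      rw [mem_ball, dist_lineMap_left, Real.norm_of_nonneg ht.1]
      exact mul_lt_of_lt_one_left (dist_pos.2 hxb') h
  have hsegc : IsCompact (segment ℝ x b) := by
    rw [segment_eq_image_lineMap]
    exact isCompact_Icc.image AffineMap.lineMap_continuous
  have hPs : Q ∪ segment ℝ x b ⊆ Ω ∪ {b} := union_subset (hQΩ.trans subset_union_left) hseg
  obtain ⟨s, hs, hsd⟩ := Metric.exists_pos_forall_lt_edist (hQ.union hsegc) hZ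
    (disjoint_left.2 fun y hy hyZ => by
      rcases hPs hy with h | h
      · have := hZf hyZ
        rw [hΩ.frontier_eq] at this
        exact this.2 h
      · exact hbZ (mem_singleton_iff.1 h ▸ hyZ))
  refine ⟨s, by exact_mod_cast hs, b, ⟨hbf, hbZ⟩, Q ∪ segment ℝ x b,
    hPs.trans (union_subset subset_closure (singleton_subset_iff.2 hbcl)),
    hQp.union x hxQ (left_mem_segment ℝ x b) (convex_segment x b).isPreconnected,
    Or.inr (right_mem_segment ℝ x b), hKQ.trans subset_union_left, fun y hy z hz => ?_⟩
  have := hsd y hy z hz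
  rw [edist_nndist, ENNReal.coe_lt_coe] at this
  exact this.le

theorem IsJordanDomain.exists_periodic_param {Ω : Set ℂ} (hΩ : IsJordanDomain Ω) :
    ∃ Γ : ℝ → ℂ, UniformContinuous Γ ∧ Function.Periodic Γ (2 * Real.pi) ∧
      (∀ a, InjOn Γ (Ico a (a + 2 * Real.pi))) ∧ range Γ = frontier Ω := by
  obtain ⟨-, -, ⟨γ, hγ, hinj, himg⟩, -⟩ := hΩ
  have hmem : ∀ θ, circleMap 0 1 θ ∈ sphere (0 : ℂ) 1 := circleMap_mem_sphere 0 zero_le_one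
  refine ⟨fun θ => γ (circleMap 0 1 θ), ?_,
    (periodic_circleMap 0 1).comp γ, fun a θ hθ φ hφ h => ?_, ?_⟩
  · rw [← uniformContinuousOn_univ]
    exact ((isCompact_sphere 0 1).uniformContinuousOn_of_continuous hγ).comp
      (lipschitzWith_circleMap 0 1).uniformContinuous.uniformContinuousOn fun θ _ => hmem θ
  · refine injOn_circleMap_of_abs_sub_le' one_ne_zero ?_ hθ hφ (hinj (hmem _) (hmem _) h)
    simp
  · rw [← himg, range_comp' γ (circleMap 0 1), range_circleMap, abs_one]

theorem exists_uniform_preconnected_away {Ω : Set ℂ} (hΩ : IsOpen Ω) (hc : IsConnected Ω)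
    (hb : Bornology.IsBounded Ω) {Γ : ℝ → ℂ} (hΓ : Continuous Γ)
    (hper : Function.Periodic Γ (2 * Real.pi)) (hinj : ∀ a, InjOn Γ (Ico a (a + 2 * Real.pi)))
    (hrange : range Γ = frontier Ω) {τ ε : ℝ} (hτ : 0 < τ) (hε : 0 < ε) :
    ∃ s > 0, ∀ a, ∃ b ∈ Γ '' Ioo a (a + τ), ∃ P ⊆ closure Ω, IsPreconnected P ∧ b ∈ P ∧
      {y ∈ Ω | ε ≤ infDist y (frontier Ω)} ⊆ P ∧
      ∀ x ∈ P, ∀ z ∈ frontier Ω, z ∉ Γ '' Ioo a (a + τ) → s ≤ dist x z := by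
  have hpi := Real.pi_gt_three
  set e := min (τ / 2) 1 with he
  have he0 : 0 < e := by positivity
  have heτ : 2 * e ≤ τ := by linarith [min_le_left (τ / 2) 1]
  have he1 : e ≤ 1 := min_le_right _ _
  have hone : ∀ a, ∃ s > 0, ∃ b ∈ Γ '' Ioo a (a + e), ∃ P ⊆ closure Ω, IsPreconnected P ∧ b ∈ P ∧
      {y ∈ Ω | ε ≤ infDist y (frontier Ω)} ⊆ P ∧
      ∀ x ∈ P, ∀ z ∈ frontier Ω, z ∉ Γ '' Ioo a (a + e) → s ≤ dist x z := by
    intro a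
    have hsplit : ∀ z ∈ frontier Ω, z ∉ Γ '' Icc (a + e) (a + 2 * Real.pi) →
        z ∈ Γ '' Ioo a (a + e) := by
      intro z hz hzZ
      rw [← hrange] at hz
      obtain ⟨θ, rfl⟩ := hz
      obtain ⟨φ, hφ, h⟩ := hper.exists_mem_Ioc (by positivity) θ a
      refine ⟨φ, ⟨hφ.1, not_le.1 fun hle => hzZ ⟨φ, ⟨hle, hφ.2⟩, h.symm⟩⟩, h.symm⟩
    obtain ⟨s, hs, b, hbf, P, hP, hPp, hbP, hKP, hPs⟩ := exists_preconnected_away hΩ hc hb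
      (Z := Γ '' Icc (a + e) (a + 2 * Real.pi)) (isCompact_Icc.image hΓ).isClosed
      (hrange ▸ image_subset_range _ _) ⟨Γ (a + e / 2), hrange ▸ mem_range_self _, by
        rintro ⟨φ, hφ, h⟩
        have := hinj (a + e / 2) ⟨by linarith [hφ.1], by linarith [hφ.2]⟩
          ⟨le_rfl, by linarith⟩ h
        linarith [hφ.1]⟩ hε
    exact ⟨s, hs, b, hsplit b hbf.1 hbf.2, P, hP, hPp, hbP, hKP, fun x hx z hz hz' =>
      hPs x hx z (by_contra fun h => hz' (hsplit z hz h))⟩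
  choose s hs hprop using hone
  obtain ⟨N, hN⟩ := exists_nat_gt (2 * Real.pi / e + 1)
  obtain ⟨s₀, hs₀, hs₀pos⟩ : ∃ s₀, (∀ k ∈ Finset.range N, s₀ < s (k * e)) ∧ 0 < s₀ := by
    have : ∀ᶠ s₀ in 𝓝[>] (0 : ℝ), ∀ k ∈ Finset.range N, s₀ < s (k * e) :=
      (Finset.eventually_all _).2 fun k _ => (eventually_lt_nhds (hs _)).filter_mono
        nhdsWithin_le_nhds
    exact (this.and self_mem_nhdsWithin).exists
  refine ⟨s₀, hs₀pos, fun a => ?_⟩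
  set a' := toIcoMod Real.two_pi_pos 0 a with ha'
  have ha'mem : a' ∈ Ico 0 (0 + 2 * Real.pi) := toIcoMod_mem_Ico _ _ _
  have hΓa : ∀ t, Γ (a' + t) = Γ (a + t) := by
    intro t
    rw [ha', toIcoMod, sub_add_eq_add_sub]
    exact hper.sub_zsmul_eq _
  have hk1 : a' ≤ ⌈a' / e⌉₊ * e := (div_le_iff₀ he0).1 (Nat.le_ceil _)
  have hk2 : (⌈a' / e⌉₊ : ℝ) < a' / e + 1 := Nat.ceil_lt_add_one (div_nonneg ha'mem.1 he0.le)
  have hk3 : ⌈a' / e⌉₊ * e < a' + e := by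
    calc _ < (a' / e + 1) * e := by gcongr
      _ = _ := by field_simp
  have hkN : ⌈a' / e⌉₊ ∈ Finset.range N := by
    rw [Finset.mem_range, ← Nat.cast_lt (α := ℝ)]
    have : a' / e ≤ 2 * Real.pi / e := by
      gcongr
      linarith [ha'mem.2]
    linarith
  set d := ⌈a' / e⌉₊ * e with hd
  have hsub : Γ '' Ioo d (d + e) ⊆ Γ '' Ioo a (a + τ) := by
    rintro _ ⟨θ, hθ, rfl⟩
    refine ⟨a + (θ - a'), ⟨by linarith [hθ.1], by linarith [hθ.2]⟩, ?_⟩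
    rw [← hΓa, add_sub_cancel]
  obtain ⟨b, hb', P, hP, hPp, hbP, hKP, hPs⟩ := hprop d
  exact ⟨b, hsub hb', P, hP, hPp, hbP, hKP, fun x hx z hz hz' =>
    (hs₀ _ hkN).le.trans (hPs x hx z hz fun h => hz' (hsub h))⟩

theorem ArcSeparated.exists_far_arc {Ωt : Set ℂ} {q : Fin 3 → ℂ} {δ τ : ℝ} {G : ℝ → ℂ}
    (hsep : ArcSeparated Ωt q δ) (hG : Continuous G) (hper : Function.Periodic G (2 * Real.pi))
    (hinj : ∀ a, InjOn G (Ico a (a + 2 * Real.pi))) (hrange : range G = frontier Ωt)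
    (hq : ∀ i, q i ∈ frontier Ωt)
    (hτ : ∀ i j, i ≠ j → ∀ θ φ, G θ = q i → G φ = q j → τ ≤ dist θ φ) {p : ℂ}
    (hp : p ∈ frontier Ωt) : ∃ a, ∀ θ ∈ Ioo a (a + τ), δ ≤ dist (G θ) p := by
  obtain ⟨i, j, hij, hk⟩ := hsep p hp
  obtain ⟨k, hki, hkj⟩ : ∃ k : Fin 3, k ≠ i ∧ k ≠ j := by
    clear hk
    decide +revert
  obtain ⟨x, hx, -, hxδ⟩ := hk k hki hkj
  set C := connectedComponentIn (frontier Ωt \ {q i, q j}) x with hC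
  have hpar : ∀ z ∈ frontier Ωt, ∀ a, ∃ θ ∈ Ico a (a + 2 * Real.pi), G θ = z := by
    intro z hz a
    rw [← hrange] at hz
    obtain ⟨θ, rfl⟩ := hz
    obtain ⟨φ, hφ, h⟩ := hper.exists_mem_Ico (by positivity) θ a
    exact ⟨φ, hφ, h.symm⟩
  obtain ⟨α, -, hα⟩ := hpar _ (hq i) 0
  obtain ⟨β, hβ, hβq⟩ := hpar _ (hq j) α
  obtain ⟨ξ, hξ, rfl⟩ := hpar _ hx.1 α
  have hα' : G (α + 2 * Real.pi) = q i := (hper α).trans hα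
  have hξα : ξ ≠ α := fun h => hx.2 (Or.inl (h ▸ hα))
  have hξβ : ξ ≠ β := fun h => hx.2 (Or.inr (h ▸ hβq))
  have h1 := hτ i j hij _ _ hα hβq
  have h2 := hτ i j hij _ _ hα' hβq
  rw [Real.dist_eq, abs_sub_comm, abs_of_nonneg (by linarith [hβ.1])] at h1
  rw [Real.dist_eq, abs_of_nonneg (by linarith [hβ.2])] at h2
  have hmemα : α ∈ Ico α (α + 2 * Real.pi) := ⟨le_rfl, by linarith [Real.pi_pos]⟩
  have hfar : ∀ a b, α ≤ a → b ≤ α + 2 * Real.pi → ξ ∈ Ioo a b → β ∉ Ioo a b → τ ≤ b - a →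
      ∀ θ ∈ Ioo a (a + τ), δ ≤ dist (G θ) p := by
    intro a b ha hb hξab hβab hτab θ hθ
    have hsub : G '' Ioo a b ⊆ frontier Ωt \ {q i, q j} := by
      rintro _ ⟨φ, hφ, rfl⟩
      have hφ' : φ ∈ Ico α (α + 2 * Real.pi) := ⟨ha.trans hφ.1.le, hφ.2.trans_le hb⟩
      refine ⟨hrange ▸ mem_range_self _, ?_⟩
      rintro (h | h)
      · have := hinj α hφ' hmemα (h.trans hα.symm)
        linarith [hφ.1]
      · have := hinj α hφ' hβ (h.trans hβq.symm)
        exact hβab (this ▸ hφ)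
    have hmem : G θ ∈ C := (isPreconnected_Ioo.image G hG.continuousOn).subset_connectedComponentIn
      ⟨ξ, hξab, rfl⟩ hsub ⟨θ, ⟨hθ.1, by linarith [hθ.2]⟩, rfl⟩
    rw [dist_comm]
    exact hxδ.trans (infDist_le_dist_of_mem hmem)
  rcases lt_or_gt_of_ne hξβ with h | h
  · exact ⟨α, hfar α β le_rfl hβ.2.le ⟨lt_of_le_of_ne hξ.1 hξα.symm, h⟩
      (fun h' => h'.2.false) h1⟩
  · exact ⟨β, hfar β (α + 2 * Real.pi) hβ.1 le_rfl ⟨h, hξ.2⟩ (fun h' => h'.1.false) h2⟩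

theorem le_dist_of_separating_circle {I J : Type*} [Finite I] {Ω Ωt P : Set ℂ}
    {c : I → ℂ} {r : I → ℝ} {ct : J → ℂ} {rt : J → ℝ} {g h : ℂ → ℂ} {p y b : ℂ} {ρ s : ℝ}
    (hΩ : IsOpen Ω) (hfam : IsSchottkyFamily Ω c r)
    (hg : MapsTo g (closure (circleDomain Ω c r)) (closure (circleDomain Ωt ct rt)))
    (hcont : ContinuousOn g (closure (circleDomain Ω c r)))
    (hhg : ∀ x ∈ closure (circleDomain Ω c r), h (g x) = x)
    (hsph : ∀ i, ∃ j, g '' sphere (c i) (r i) = sphere (ct j) (rt j) ∧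
      ∀ w ∈ closedBall (ct j) (rt j), dist w p = ρ → 2 * r i < s)
    (hcirc : ∀ w ∈ closure (circleDomain Ωt ct rt), dist w p = ρ →
      ∃ z ∈ frontier Ωt, dist z p = ρ ∧ dist (h w) (h z) < s)
    (hP : IsPreconnected P) (hPΩ : P ⊆ closure Ω)
    (hfar : ∀ x ∈ P, ∀ z ∈ frontier Ωt, dist z p = ρ → 2 * s ≤ dist x (h z))
    (hy : y ∈ P) (hyA : y ∈ closure (circleDomain Ω c r))
    (hb : b ∈ P) (hbA : b ∈ closure (circleDomain Ω c r)) (hbρ : ρ < dist (g b) p) :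
    ρ ≤ dist (g y) p := by
  by_contra! hyρ
  refine hP.false_of_finite_pieces (X₀ := closure (circleDomain Ω c r))
    (X := fun i => closedBall (c i) (r i)) (f := fun x => dist (g x) p) (v := ρ) isClosed_closure
    (fun _ => isClosed_closedBall) hfam.2.2 (fun x hx => ?_)
    ((continuous_id.dist continuous_const).comp_continuousOn hcont) (fun x hxP hxA hx => ?_)
    (fun i => ?_) hy hyA hb hbA hyρ hbρ
  · exact (closure_subset_closure_circleDomain_union hΩ hfam (hPΩ hx)).imp_right
      fun h' => iUnion_mono (fun _ => ball_subset_closedBall) h'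
  · obtain ⟨z, hz, hzρ, hzs⟩ := hcirc (g x) (hg hxA) hx
    rw [hhg x hxA] at hzs
    linarith [hfar x hxP z hz hzρ, dist_nonneg (x := x) (y := h z)]
  · obtain ⟨j, hj, hrad⟩ := hsph i
    have himage : ∀ x ∈ closure (circleDomain Ω c r), x ∈ closedBall (c i) (r i) →
        g x ∈ sphere (ct j) (rt j) := fun x hxA hxi => by
      rw [← hj]
      exact mem_image_of_mem g (mem_sphere_of_mem_closure_circleDomain hxA hxi)
    have hord : (∀ w ∈ sphere (ct j) (rt j), dist w p < ρ) ∨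
        (∀ w ∈ sphere (ct j) (rt j), ρ < dist w p) ∨ ∃ w ∈ sphere (ct j) (rt j), dist w p = ρ := by
      by_cases hlt : ∀ w ∈ sphere (ct j) (rt j), dist w p < ρ
      · exact Or.inl hlt
      by_cases hgt : ∀ w ∈ sphere (ct j) (rt j), ρ < dist w p
      · exact Or.inr (Or.inl hgt)
      push Not at hlt hgt
      obtain ⟨w₁, hw₁, h₁⟩ := hlt
      obtain ⟨w₂, hw₂, h₂⟩ := hgt
      have hconn : IsPreconnected (sphere (ct j) (rt j)) :=
        isPreconnected_sphere (by rw [Complex.rank_real_complex]; norm_num) _ _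
      exact Or.inr (Or.inr (hconn.intermediate_value hw₂ hw₁
        (continuous_id.dist continuous_const).continuousOn ⟨h₂, h₁⟩))
    rcases hord with hlt | hgt | ⟨w, hw, hwρ⟩
    · exact Or.inl fun x _ hxA hxi => hlt _ (himage x hxA hxi)
    · exact Or.inr fun x _ hxA hxi => hgt _ (himage x hxA hxi)
    · have hwj := sphere_subset_closedBall hw
      rw [← hj] at hw
      obtain ⟨u, hu, rfl⟩ := hw
      have huA := sphere_subset_closure_circleDomain hΩ hfam i hu
      obtain ⟨z, hz, hzρ, hzs⟩ := hcirc (g u) (hg huA) hwρ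
      rw [hhg u huA] at hzs
      refine Or.inl fun x hxP _ hxi => ?_
      have h₁ := hfar x hxP z hz hzρ
      have h₂ := hrad _ hwj hwρ
      have h₃ := dist_triangle x u (h z)
      have h₄ := dist_triangle_right x u (c i)
      have h₅ : dist x (c i) ≤ r i := hxi
      have h₆ : dist u (c i) = r i := hu
      linarith

/-- uniform properness: quantitative lower bound on the distance of
`g(K ∩ closure A)` to `∂Ω̃` for conformal maps of relative circle domains obtained from a
fixed relative Schottky set, depending only on `Ω`, `S`, `δ` and `ε`. -/
theorem uniform_properness
    (Ω : Set ℂ) {I : Type} (c : I → ℂ) (r : I → ℝ)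
    (hΩ : IsJordanDomain Ω) (hfam : IsSchottkyFamily Ω c r)
    (S : Set ℂ) (hS : S = Ω \ ⋃ i, ball (c i) (r i))
    (δ ε : ℝ) (hδ : 0 < δ) (hε : 0 < ε) :
    ∃ εt : ℝ, 0 < εt ∧
      ∀ (I' : Set I), I'.Finite →
      ∀ (A : Set ℂ), A = Ω \ ⋃ i ∈ I', closedBall (c i) (r i) →
      ∀ (Ωt : Set ℂ), IsJordanDomain Ωt →
      ∀ (n : ℕ) (ct : Fin n → ℂ) (rt : Fin n → ℝ), IsSchottkyFamily Ωt ct rt →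
      ∀ (At : Set ℂ), At = Ωt \ ⋃ j, closedBall (ct j) (rt j) →
      ∀ g : ℂ → ℂ, IsHomeoOn g (closure A) (closure At) →
        DifferentiableOn ℂ g A → (∀ z ∈ A, deriv g z ≠ 0) →
        g '' frontier Ω = frontier Ωt →
        (∀ i ∈ I', ∃ j, g '' sphere (c i) (r i) = sphere (ct j) (rt j)) →
      ∀ p : Fin 3 → ℂ, (∀ i, p i ∈ frontier Ω) →
        (Pairwise fun i j => δ ≤ dist (p i) (p j)) →
        ArcSeparated Ωt (fun i => g (p i)) δ →
      ∀ K : Set ℂ, K ⊆ Ω → IsCompact K →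
        (∀ x ∈ K, ε ≤ infDist x (frontier Ω)) →
        ∀ y ∈ K ∩ closure A, εt ≤ infDist (g y) (frontier Ωt) := by
  subst hS
  have hΩo := hΩ.1.1
  have hΩb := hΩ.2.1
  obtain ⟨Γ, hΓuc, hper, hinj, hrange⟩ := hΩ.exists_periodic_param
  have hΓ := hΓuc.continuous
  have hne : (frontier Ω).Nonempty := hrange ▸ range_nonempty Γ
  obtain ⟨τ, hτ, hΓτ⟩ := Metric.uniformContinuous_iff.1 hΓuc δ hδ
  obtain ⟨s, hs, hsource⟩ :=
    exists_uniform_preconnected_away hΩo hΩ.1.2 hΩb hΓ hper hinj hrange hτ hε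
  obtain ⟨η, hη, hηδ, hcircle⟩ :=
    IsCircleDomainInverse.exists_uniform_circle hΩo hΩb hne hfam hδ (half_pos hs)
  refine ⟨η, hη, ?_⟩
  rintro I' hI' A rfl Ωt hΩt n ct rt hfamt At rfl g hg hdiff hderiv hfr hsph p hp hpδ hsep K hKΩ -
    hKε y ⟨hyK, hyA⟩
  have := hI'.to_subtype
  have hΩto := hΩt.1.1
  have hfam' : IsSchottkyFamily Ω (fun i : I' => c i) fun i : I' => r i :=
    ⟨fun i => hfam.1 i, fun i => hfam.2.1 i, fun i j hij =>
      hfam.2.2 fun h => hij (Subtype.ext h)⟩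
  have hA : Ω \ ⋃ i ∈ I', closedBall (c i) (r i) =
      circleDomain Ω (fun i : I' => c i) fun i : I' => r i := by
    rw [biUnion_eq_iUnion, circleDomain]
  rw [hA] at hg hdiff hderiv hyA
  change IsHomeoOn g _ (closure (circleDomain Ωt ct rt)) at hg
  obtain ⟨hgm, hgc, h, hhm, hhc, hhg, hgh⟩ := hg.exists_inverse
  obtain ⟨σ, H, hσ, hσsph⟩ := exists_isCircleDomainInverse hΩo hΩto hfam' hfamt hgm hhm hhc hhg hgh
    hdiff hderiv hfr fun i => hsph i i.2
  have H' : IsCircleDomainInverse Ω c r Ωt ct rt h (Subtype.val ∘ σ) :=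
    ⟨H.continuousOn, H.differentiableOn, H.injOn, H.mapsTo, H.notMem, H.mapsTo_sphere,
      H.mapsTo_frontier, Subtype.val_injective.comp H.injective⟩
  have hfrA := frontier_subset_closure_circleDomain hΩo hfam'.2.1
  have hfrAt := frontier_subset_closure_circleDomain hΩto hfamt.2.1
  have hΓfr : ∀ θ, Γ θ ∈ frontier Ω := fun θ => hrange ▸ mem_range_self θ
  have hgfr : ∀ x ∈ frontier Ω, g x ∈ frontier Ωt := fun x hx => hfr ▸ mem_image_of_mem g hx
  have hG : Continuous (g ∘ Γ) :=
    hgc.comp_continuous hΓ fun θ => hfrA (hΓfr θ)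
  have hGinj : ∀ θ, ∀ x ∈ frontier Ω, g (Γ θ) = g x → Γ θ = x := fun θ x hx hθ => by
    rw [← hhg _ (hfrA (hΓfr θ)), hθ, hhg _ (hfrA hx)]
  have hGrange : range (g ∘ Γ) = frontier Ωt := by rw [range_comp, hrange, hfr]
  by_contra! hlt
  obtain ⟨pt, hpt, hypt⟩ := (infDist_lt_iff (hGrange ▸ range_nonempty _)).1 hlt
  obtain ⟨a, ha⟩ := hsep.exists_far_arc hG (hper.comp g)
    (fun a θ hθ φ hφ hθφ => hinj a hθ hφ (hGinj θ _ (hΓfr φ) hθφ)) hGrange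
    (fun i => hgfr _ (hp i)) (τ := τ) (fun i j hij θ φ hθ hφ => by
      by_contra! hdist
      have := hΓτ hdist
      rw [hGinj θ _ (hp i) hθ, hGinj φ _ (hp j) hφ] at this
      exact (hpδ hij).not_gt this) hpt
  obtain ⟨b, ⟨θ, hθ, rfl⟩, P, hPΩ, hP, hbP, hKP, hfar⟩ := hsource a
  obtain ⟨ρ, ⟨hηρ, hρδ⟩, hcirc, hrad⟩ := hcircle H' hΩto hfamt
    (hGrange ▸ isPreconnected_range hG) pt hpt ⟨_, hgfr _ (hΓfr θ), ha θ hθ⟩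
  refine absurd (hypt.trans hηρ) (not_lt.2 ?_)
  refine le_dist_of_separating_circle hΩo hfam' hgm hgc hhg (fun i => ?_) hcirc hP hPΩ
    (fun x hx z hz hzρ => ?_) (hKP ⟨hKΩ hyK, hKε y hyK⟩) hyA hbP (hfrA (hΓfr θ))
    (hρδ.trans_le (ha θ hθ))
  · obtain ⟨j, rfl⟩ := hσ i
    exact ⟨j, hσsph j, hrad j⟩
  · rw [mul_div_cancel₀ s two_ne_zero]
    refine hfar x hx _ (H.mapsTo_frontier hz) ?_
    rintro ⟨φ, hφ, hφz⟩
    have := ha φ hφ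
    rw [Function.comp_apply, hφz, hgh z (hfrAt hz), hzρ] at this
    exact hρδ.not_ge this
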